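/- arXiv:2108.04302 — 9 statements merged into one kernel-verified Lean document; each statement's English description precedes it below -/
import Mathlib

section
/- For every n ≥ 1, the number of leaves after n steps of the restricted generating tree of weak-ordering chains with stopping condition x_i = x_j (i ≠ j) equals 2·n! − 1; that is, the number of ordered set partitions of [n] all of whose blocks are singletons, plus the sum over j = 1,…,n of the number of ordered set partitions of [j] having some block of size at least 2 whose restriction to [j−1] has all blocks singletons, equals 2·n! − 1. -/
/-- A function `p : Fin n → Fin n` encodes an ordered set partition of `{1, …, n}`
when the set of values it attains is an initial segment of `Fin n`: `p i` is the
0-based index of the block containing `i` (so the 1-based position `pos(i)` of the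
block containing `i` equals `p i + 1`, and comparisons between `pos` values
correspond to comparisons between values of `p`). -/
def IsOSP {n : ℕ} (p : Fin n → Fin n) : Prop :=
  ∀ i v, v ≤ p i → ∃ j, p j = v

/- Deleting the element `n` from an ordered set partition of `[n]` preserves block
membership and the relative order of the blocks of the remaining elements, so the
restriction to `[n-1]` contains a given stopping condition iff the condition occurs
with all of its witnesses among the elements of `[n-1]`, i.e. among the indices `i`
with `i.val < n - 1`. -/

theorem isOSP_of_injective {n : ℕ} {p : Fin n → Fin n} (hp : Function.Injective p) : IsOSP p :=
  fun _ v _ => Finite.surjective_of_injective hp v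

/-- Ordered set partitions of `[n]` into singletons correspond to permutations. -/
theorem card_isOSP_injective (n : ℕ) :
    Nat.card {p : Fin n → Fin n // IsOSP p ∧ ∀ i j, p i = p j → i = j} = n.factorial := by
  let f : Equiv.Perm (Fin n) → {p : Fin n → Fin n // IsOSP p ∧ ∀ i j, p i = p j → i = j} :=
    fun σ => ⟨σ, isOSP_of_injective σ.injective, fun _ _ h => σ.injective h⟩
  have hf : Function.Bijective f := by
    constructor
    · intro σ τ h
      exact DFunLike.coe_injective (congrArg Subtype.val h)
    · rintro ⟨p, _, hp⟩
      exact ⟨Equiv.ofBijective p (Finite.injective_iff_bijective.mp hp), rfl⟩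
  rw [← Nat.card_congr (Equiv.ofBijective f hf), Nat.card_perm, Nat.card_fin]

theorem IsOSP.ne_last_of_not_injective {m : ℕ} {p : Fin (m + 1) → Fin (m + 1)} (hp : IsOSP p)
    (hinj : ¬ Function.Injective p) (i : Fin (m + 1)) : p i ≠ Fin.last m := by
  intro h
  exact hinj (Finite.injective_iff_surjective.mpr fun v => hp i v (h ▸ Fin.le_last v))

/-- An ordered set partition of `[m + 1]` with a tie, whose restriction to `[m]` has none, is
determined by the order of `[m]` and the element of `[m]` tied with the last one. -/
theorem card_isOSP_first_tie (m : ℕ) :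
    Nat.card {p : Fin (m + 1) → Fin (m + 1) // IsOSP p ∧ (∃ a b, a ≠ b ∧ p a = p b) ∧
      ∀ a b : Fin (m + 1), a.val < m + 1 - 1 → b.val < m + 1 - 1 → p a = p b → a = b}
      = m.factorial * m := by
  let g : Equiv.Perm (Fin m) × Fin m → Fin (m + 1) → Fin (m + 1) := fun x =>
    Fin.snoc (α := fun _ => Fin (m + 1)) (fun i => (x.1 i).castSucc) x.2.castSucc
  have g_castSucc (x) (i : Fin m) : g x i.castSucc = (x.1 i).castSucc := by simp [g]
  have g_last (x) : g x (Fin.last m) = x.2.castSucc := by simp [g]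
  have hg (x) : IsOSP (g x) ∧ (∃ a b, a ≠ b ∧ g x a = g x b) ∧
      ∀ a b : Fin (m + 1), a.val < m + 1 - 1 → b.val < m + 1 - 1 → g x a = g x b → a = b := by
    refine ⟨fun i v hv => ?_, ⟨(x.1.symm x.2).castSucc, Fin.last m, Fin.castSucc_ne_last _, ?_⟩, ?_⟩
    · cases v using Fin.lastCases with
      | last =>
        exfalso
        rw [Fin.last_le_iff] at hv
        cases i using Fin.lastCases with
        | last => exact Fin.castSucc_ne_last _ (g_last x ▸ hv)
        | cast i => exact Fin.castSucc_ne_last _ (g_castSucc x i ▸ hv)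
      | cast w => exact ⟨(x.1.symm w).castSucc, by simp [g_castSucc]⟩
    · simp [g_castSucc, g_last]
    · intro a b ha hb h
      obtain ⟨a, rfl⟩ : ∃ c : Fin m, c.castSucc = a := ⟨⟨a, ha⟩, rfl⟩
      obtain ⟨b, rfl⟩ : ∃ c : Fin m, c.castSucc = b := ⟨⟨b, hb⟩, rfl⟩
      simpa [g_castSucc] using h
  have hbij : Function.Bijective fun x => (⟨g x, hg x⟩ : {p : Fin (m + 1) → Fin (m + 1) //
      IsOSP p ∧ (∃ a b, a ≠ b ∧ p a = p b) ∧
        ∀ a b : Fin (m + 1), a.val < m + 1 - 1 → b.val < m + 1 - 1 → p a = p b → a = b}) := by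
    constructor
    · intro x y h
      have h' : g x = g y := congrArg Subtype.val h
      refine Prod.ext (Equiv.ext fun i => ?_) ?_
      · simpa [g_castSucc] using congrFun h' i.castSucc
      · simpa [g_last] using congrFun h' (Fin.last m)
    · rintro ⟨p, hp, ⟨a, b, hab, hpab⟩, hinj⟩
      have hne := hp.ne_last_of_not_injective fun h => hab (h hpab)
      have hq : Function.Injective fun i : Fin m => (p i.castSucc).castPred (hne _) := by
        intro i j h
        exact Fin.castSucc_injective m (hinj _ _ i.isLt j.isLt (Fin.castPred_inj.mp h))
      refine ⟨(Equiv.ofBijective _ (Finite.injective_iff_bijective.mp hq),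
        (p (Fin.last m)).castPred (hne _)), Subtype.ext (funext fun i => ?_)⟩
      cases i using Fin.lastCases with
      | last => simp [g_last]
      | cast i => simp [g_castSucc]
  rw [← Nat.card_congr (Equiv.ofBijective _ hbij), Nat.card_prod, Nat.card_perm, Nat.card_fin]

/-- Stopping condition `x_i = x_j` (`i ≠ j`): the number of leaves after `n` steps,
namely the number of ordered set partitions of `[n]` all of whose blocks are
singletons, plus, for each `j = 1, …, n`, the number of ordered set partitions of
`[j]` having some block of size at least 2 but whose restriction to `[j-1]` has all
blocks singletons, equals `2 · n! - 1`. -/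
theorem woc_stop_eq (n : ℕ) (hn : 1 ≤ n) :
    Nat.card {p : Fin n → Fin n // IsOSP p ∧ ∀ i j, p i = p j → i = j} +
      ∑ j ∈ Finset.Icc 1 n,
        Nat.card {p : Fin j → Fin j // IsOSP p ∧ (∃ a b, a ≠ b ∧ p a = p b) ∧
          ∀ a b : Fin j, a.val < j - 1 → b.val < j - 1 → p a = p b → a = b}
      = 2 * n.factorial - 1 := by
  rw [card_isOSP_injective, Finset.sum_congr (g := fun j => (j - 1).factorial * (j - 1)) rfl]
  · have h (k : ℕ) :
        ∑ j ∈ Finset.Icc 1 k, (j - 1).factorial * (j - 1) + 1 = k.factorial := by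
      induction k with
      | zero => simp
      | succ k ih =>
        rw [Finset.sum_Icc_succ_top (by lia), Nat.factorial_succ, Nat.add_sub_cancel]
        linarith
    have := h n
    lia
  · intro j hj
    obtain ⟨m, rfl⟩ := Nat.exists_eq_add_of_le' (Finset.mem_Icc.mp hj).1
    exact card_isOSP_first_tie m
end

section
/- For every n ≥ 1, the number of leaves after n steps of the restricted generating tree of weak-ordering chains with stopping condition x_i < x_j (i < j) equals (n−1)·2^{n−1} + 1. -/
/- Deleting the element `n` from an ordered set partition of `[n]` preserves block
membership and the relative order of the blocks of the remaining elements, so the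
restriction to `[n-1]` contains a given stopping condition iff the condition occurs
with all of its witnesses among the elements of `[n-1]`, i.e. among the indices `i`
with `i.val < n - 1`. -/

open Finset in
/-- The number of elements of `s` that are at least `i`. If `s` is the set of descents of an
antitone ordered set partition, this is the position of the block containing `i`. -/
def descentsFrom (s : Finset ℕ) (i : ℕ) : ℕ := #{x ∈ s | i ≤ x}

lemma descentsFrom_zero (s : Finset ℕ) : descentsFrom s 0 = s.card := by
  simp [descentsFrom]

lemma descentsFrom_le_card (s : Finset ℕ) (i : ℕ) : descentsFrom s i ≤ s.card :=
  Finset.card_filter_le _ _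

lemma descentsFrom_eq_zero {s : Finset ℕ} {m i : ℕ} (hs : s ⊆ Finset.range m) (hi : m ≤ i) :
    descentsFrom s i = 0 := by
  rw [descentsFrom, Finset.card_eq_zero, Finset.filter_eq_empty_iff]
  intro x hx
  have := Finset.mem_range.1 (hs hx)
  omega

lemma descentsFrom_eq_succ_add (s : Finset ℕ) (i : ℕ) :
    descentsFrom s i = descentsFrom s (i + 1) + if i ∈ s then 1 else 0 := by
  unfold descentsFrom
  split_ifs with h
  · rw [← Finset.card_insert_of_notMem (a := i) (by simp)]
    congr 1
    ext x
    simp only [Finset.mem_filter, Finset.mem_insert]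
    grind
  · rw [add_zero]
    congr 1
    ext x
    simp only [Finset.mem_filter]
    grind

lemma descentsFrom_antitone (s : Finset ℕ) : Antitone (descentsFrom s) :=
  antitone_nat_of_succ_le fun i => by
    have := descentsFrom_eq_succ_add s i
    omega

lemma mem_iff_descentsFrom_lt (s : Finset ℕ) (i : ℕ) :
    i ∈ s ↔ descentsFrom s (i + 1) < descentsFrom s i := by
  have := descentsFrom_eq_succ_add s i
  split_ifs at this <;> simp_all

lemma exists_descentsFrom_eq {s : Finset ℕ} {m v : ℕ} (hs : s ⊆ Finset.range m)
    (hv : v ≤ s.card) : ∃ i ≤ m, descentsFrom s i = v := by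
  have hex : ∃ i, descentsFrom s i ≤ v := ⟨m, by simp [descentsFrom_eq_zero hs le_rfl]⟩
  classical
  refine ⟨Nat.find hex, Nat.find_min' hex (by simp [descentsFrom_eq_zero hs le_rfl]), ?_⟩
  have h1 := Nat.find_spec hex
  rcases hk : Nat.find hex with _ | k
  · rw [hk, descentsFrom_zero] at h1
    rw [descentsFrom_zero]
    omega
  · have h2 := Nat.find_min hex (m := k) (by omega)
    rw [hk] at h1
    have := descentsFrom_eq_succ_add s k
    split_ifs at this <;> omega

lemma eq_descentsFrom {u : ℕ → ℕ} {m : ℕ} (h0 : u m = 0)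
    (hstep : ∀ i < m, u (i + 1) ≤ u i ∧ u i ≤ u (i + 1) + 1) {i : ℕ} (hi : i ≤ m) :
    u i = descentsFrom {x ∈ Finset.range m | u (x + 1) < u x} i := by
  induction hi using Nat.decreasingInduction with
  | self => rw [h0, descentsFrom_eq_zero (Finset.filter_subset _ _) le_rfl]
  | of_succ k hk ih =>
    rw [descentsFrom_eq_succ_add, ← ih]
    have := hstep k hk
    simp only [Finset.mem_filter, Finset.mem_range]
    split_ifs <;> omega

/-- Position function obtained from the antitone ordered set partition of `{0, …, m}` with
descent set `s` by inserting `m + 1`: into block `h / 2` if `h` is even, and as a new block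
immediately before block `(h + 1) / 2` if `h` is odd. -/
def insertLast (m : ℕ) (s : Finset ℕ) (h i : ℕ) : ℕ :=
  if i = m + 1 then (h + 1) / 2
  else if h % 2 = 1 ∧ h < 2 * descentsFrom s i then descentsFrom s i + 1
  else descentsFrom s i

lemma insertLast_le {m h : ℕ} {s : Finset ℕ} (hs : s ⊆ Finset.range m)
    (hh : h ≤ 2 * s.card + 1) (i : ℕ) : insertLast m s h i ≤ m + 1 := by
  have h1 := descentsFrom_le_card s i
  have h2 := Finset.card_le_card hs
  rw [Finset.card_range] at h2
  unfold insertLast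
  split_ifs <;> omega

lemma insertLast_antitone {m h i k : ℕ} {s : Finset ℕ} (hik : i ≤ k) (hk : k ≤ m) :
    insertLast m s h k ≤ insertLast m s h i := by
  have := descentsFrom_antitone s hik
  unfold insertLast
  split_ifs <;> omega

lemma mem_iff_insertLast_lt {m h i : ℕ} {s : Finset ℕ} (hi : i < m) :
    i ∈ s ↔ insertLast m s h (i + 1) < insertLast m s h i := by
  rw [mem_iff_descentsFrom_lt]
  unfold insertLast
  split_ifs <;> omega

lemma exists_insertLast_eq {m h i v : ℕ} {s : Finset ℕ} (hs : s ⊆ Finset.range m)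
    (hh : h ≤ 2 * s.card + 1) (hv : v ≤ insertLast m s h i) :
    ∃ k ≤ m + 1, insertLast m s h k = v := by
  by_cases hvl : v = (h + 1) / 2
  · exact ⟨m + 1, le_rfl, by simp [insertLast, hvl]⟩
  have h1 := descentsFrom_le_card s i
  by_cases hlt : h % 2 = 1 ∧ h < 2 * v
  · obtain ⟨k, hk, hkv⟩ := exists_descentsFrom_eq hs (v := v - 1) (by
      unfold insertLast at hv
      split_ifs at hv <;> omega)
    refine ⟨k, by omega, ?_⟩
    unfold insertLast
    split_ifs <;> omega
  · obtain ⟨k, hk, hkv⟩ := exists_descentsFrom_eq hs (v := v) (by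
      unfold insertLast at hv
      split_ifs at hv <;> omega)
    refine ⟨k, by omega, ?_⟩
    unfold insertLast
    split_ifs <;> omega

lemma insertLast_inj {m h h' : ℕ} {s s' : Finset ℕ} (hs : s ⊆ Finset.range m)
    (hs' : s' ⊆ Finset.range m) (hh : h ≤ 2 * s.card + 1) (hh' : h' ≤ 2 * s'.card + 1)
    (heq : ∀ i ≤ m + 1, insertLast m s h i = insertLast m s' h' i) : s = s' ∧ h = h' := by
  have hss : s = s' := by
    ext i
    by_cases hi : i < m
    · rw [mem_iff_insertLast_lt (h := h) hi, mem_iff_insertLast_lt (h := h') hi,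
        heq i (by omega), heq (i + 1) (by omega)]
    · exact iff_of_false (fun hx => hi (Finset.mem_range.1 (hs hx)))
        fun hx => hi (Finset.mem_range.1 (hs' hx))
  subst hss
  refine ⟨rfl, ?_⟩
  have hl := heq (m + 1) le_rfl
  simp only [insertLast, if_true] at hl
  by_contra hne
  obtain ⟨k, hk, hkv⟩ := exists_descentsFrom_eq hs (v := (h + 1) / 2) (by omega)
  have := heq k (by omega)
  unfold insertLast at this
  split_ifs at this <;> omega

lemma exists_eq_insertLast {m : ℕ} {q : ℕ → ℕ}
    (hosp : ∀ i ≤ m + 1, ∀ v ≤ q i, ∃ k ≤ m + 1, q k = v) (hpos : 0 < q (m + 1))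
    (hanti : ∀ i k, i ≤ k → k ≤ m → q k ≤ q i) :
    ∃ s ⊆ Finset.range m, ∃ h, 1 ≤ h ∧ h ≤ 2 * s.card + 1 ∧
      ∀ i ≤ m + 1, insertLast m s h i = q i := by
  have hattain : ∀ i ≤ m + 1, ∀ v ≤ q i, v ≠ q (m + 1) → ∃ k ≤ m, q k = v := by
    intro i hi v hv hne
    obtain ⟨k, hk, rfl⟩ := hosp i hi v hv
    exact ⟨k, by rcases hk.lt_or_eq with h | rfl <;> [omega; exact absurd rfl hne], rfl⟩
  have hm : q m = 0 := by
    obtain ⟨k, hk, hk0⟩ := hattain (m + 1) le_rfl 0 (by omega) (by omega)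
    have := hanti k m hk le_rfl
    omega
  have hgap : ∀ i < m, ∀ v, q (i + 1) < v → v < q i → ∀ k ≤ m, q k ≠ v := by
    intro i hi v h1 h2 k hk hkv
    rcases le_or_gt k i with h | h
    · have := hanti k i h hi.le
      omega
    · have := hanti (i + 1) k h hk
      omega
  by_cases hjoin : ∃ k ≤ m, q k = q (m + 1)
  · obtain ⟨k, hk, hkv⟩ := hjoin
    have hq : ∀ i ≤ m, q i = _ := fun i hi => eq_descentsFrom hm (fun i hi => by
      refine ⟨hanti i (i + 1) (by omega) hi, ?_⟩
      by_contra! hlt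
      by_cases hv : q (i + 1) + 1 = q (m + 1)
      · exact hgap i hi _ (Nat.lt_succ_self _) hlt k hk (by omega)
      · obtain ⟨l, hl, hlv⟩ := hattain i (by omega) _ hlt.le hv
        exact hgap i hi _ (Nat.lt_succ_self _) hlt l hl hlv) hi
    refine ⟨{x ∈ Finset.range m | q (x + 1) < q x}, Finset.filter_subset _ _, 2 * q (m + 1), by omega, ?_, fun i hi => ?_⟩
    · rw [← descentsFrom_zero, ← hq 0 (by omega)]
      have := hanti 0 k (by omega) hk
      omega
    · unfold insertLast
      rcases hi.lt_or_eq with h | rfl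
      · rw [← hq i (by omega)]
        split_ifs <;> omega
      · simp only [if_true]
        omega
  · push Not at hjoin
    let u : ℕ → ℕ := fun i => if q (m + 1) < q i then q i - 1 else q i
    have hq : ∀ i ≤ m, u i = _ := fun i hi => eq_descentsFrom (by simp [u, hm]) (fun i hi => by
      have h1 := hanti i (i + 1) (by omega) hi
      have h2 := hjoin i (by omega)
      have h3 := hjoin (i + 1) (by omega)
      refine ⟨by simp only [u]; split_ifs <;> omega, ?_⟩
      by_contra! hlt
      obtain ⟨v, hv1, hv2, hv3⟩ : ∃ v, q (i + 1) < v ∧ v < q i ∧ v ≠ q (m + 1) := by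
        by_cases hv : q (i + 1) + 1 = q (m + 1)
        · refine ⟨q (i + 1) + 2, by omega, ?_, by omega⟩
          simp only [u] at hlt
          split_ifs at hlt <;> omega
        · refine ⟨q (i + 1) + 1, by omega, ?_, hv⟩
          simp only [u] at hlt
          split_ifs at hlt <;> omega
      obtain ⟨l, hl, hlv⟩ := hattain i (by omega) v hv2.le hv3
      exact hgap i hi v hv1 hv2 l hl hlv) hi
    refine ⟨{x ∈ Finset.range m | u (x + 1) < u x}, Finset.filter_subset _ _, 2 * q (m + 1) - 1, by omega, ?_, fun i hi => ?_⟩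
    · rw [← descentsFrom_zero, ← hq 0 (by omega)]
      obtain ⟨k, hk, hkv⟩ := hattain (m + 1) le_rfl (q (m + 1) - 1) (by omega) (by omega)
      have := hanti 0 k (by omega) hk
      simp only [u]
      split_ifs <;> omega
    · unfold insertLast
      rcases hi.lt_or_eq with h | rfl
      · rw [← hq i (by omega)]
        have := hjoin i (by omega)
        simp only [u]
        split_ifs <;> omega
      · simp only [if_true]
        omega

lemma card_antitone_osp (m : ℕ) :
    Nat.card {p : Fin (m + 1) → Fin (m + 1) // IsOSP p ∧ ¬ ∃ i j, i < j ∧ p i < p j} =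
      2 ^ m := by
  let f : Finset ℕ → Fin (m + 1) → Fin (m + 1) := fun s i => Fin.ofNat (m + 1) (descentsFrom s i)
  have hf : ∀ s ⊆ Finset.range m, ∀ i, (f s i : ℕ) = descentsFrom s i := by
    intro s hs i
    have h1 := descentsFrom_le_card s i
    have h2 := Finset.card_le_card hs
    rw [Finset.card_range] at h2
    exact Nat.mod_eq_of_lt (by omega)
  have himage : {p : Fin (m + 1) → Fin (m + 1) | IsOSP p ∧ ¬ ∃ i j, i < j ∧ p i < p j} =
      f '' ((Finset.range m).powerset : Set (Finset ℕ)) := by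
    ext p
    simp only [Set.mem_ofPred_eq, Set.mem_image, Finset.mem_coe, Finset.mem_powerset]
    constructor
    · rintro ⟨hosp, hanti⟩
      push Not at hanti
      have hanti' : ∀ i j, i ≤ j → p j ≤ p i := fun i j h =>
        h.eq_or_lt.elim (fun h => h ▸ le_rfl) (hanti i j)
      let q : ℕ → ℕ := fun i => p (Fin.ofNat (m + 1) i)
      have hqp : ∀ i : Fin (m + 1), q i = p i := fun i => by simp [q]
      have hq : ∀ i ≤ m, q i = _ := fun i hi => eq_descentsFrom (m := m) (by
        obtain ⟨j, hj⟩ := hosp 0 0 (Fin.zero_le _)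
        have := hanti' j (Fin.last m) (Fin.le_last j)
        rw [hj] at this
        have h0 := hqp (Fin.last m)
        rw [Fin.val_last] at h0
        rw [h0, Fin.le_zero_iff.1 this, Fin.val_zero]) (fun i hi => by
        have e1 : q i = p ⟨i, by omega⟩ := hqp ⟨i, by omega⟩
        have e2 : q (i + 1) = p ⟨i + 1, by omega⟩ := hqp ⟨i + 1, by omega⟩
        rw [e1, e2]
        refine ⟨hanti' _ _ (by simp [Fin.le_def]), ?_⟩
        by_contra! hlt
        obtain ⟨k, hk⟩ := hosp ⟨i, by omega⟩ ⟨p ⟨i + 1, by omega⟩ + 1, by omega⟩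
          (by rw [Fin.le_def]; exact hlt.le)
        have hk' := congrArg Fin.val hk
        simp only at hk'
        rcases le_or_gt k.val i with h | h
        · have := Fin.le_def.1 (hanti' k ⟨i, by omega⟩ h)
          omega
        · have := Fin.le_def.1 (hanti' ⟨i + 1, by omega⟩ k h)
          omega) hi
      refine ⟨{x ∈ Finset.range m | q (x + 1) < q x}, Finset.filter_subset _ _, funext fun i => Fin.ext ?_⟩
      rw [hf _ (Finset.filter_subset _ _), ← hqp, ← hq i (by omega)]
    · rintro ⟨s, hs, rfl⟩
      refine ⟨fun i v hv => ?_, ?_⟩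
      · rw [Fin.le_def, hf s hs] at hv
        obtain ⟨k, hk, hkv⟩ := exists_descentsFrom_eq hs (hv.trans (descentsFrom_le_card s i))
        exact ⟨⟨k, by omega⟩, Fin.ext ((hf s hs _).trans hkv)⟩
      · rintro ⟨i, j, hij, hlt⟩
        rw [Fin.lt_def, hf s hs, hf s hs] at hlt
        exact hlt.not_ge (descentsFrom_antitone s hij.le)
  have hinj : Set.InjOn f ((Finset.range m).powerset : Set (Finset ℕ)) := by
    intro s hs t ht hst
    simp only [Finset.mem_coe, Finset.mem_powerset] at hs ht
    have heq : ∀ i ≤ m, descentsFrom s i = descentsFrom t i := fun i hi => by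
      have := congrArg Fin.val (congrFun hst ⟨i, by omega⟩)
      rwa [hf s hs, hf t ht] at this
    ext i
    by_cases hi : i < m
    · rw [mem_iff_descentsFrom_lt, mem_iff_descentsFrom_lt, heq i hi.le, heq (i + 1) hi]
    · exact iff_of_false (fun hx => hi (Finset.mem_range.1 (hs hx)))
        fun hx => hi (Finset.mem_range.1 (ht hx))
  change Nat.card ↥{p : Fin (m + 1) → Fin (m + 1) | IsOSP p ∧ ¬ ∃ i j, i < j ∧ p i < p j} = _
  rw [himage, Nat.card_coe_set_eq, hinj.ncard_image, Set.ncard_coe_finset,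
    Finset.card_powerset, Finset.card_range]

lemma sum_powerset_two_mul_card_add_one (m : ℕ) :
    ∑ s ∈ (Finset.range m).powerset, (2 * s.card + 1) = (m + 1) * 2 ^ m := by
  induction m with
  | zero => simp
  | succ m ih =>
    rw [Finset.range_add_one, Finset.sum_powerset_insert Finset.notMem_range_self, ih,
      Finset.sum_congr rfl (g := fun s => (2 * s.card + 1) + 2) fun s hs => by
        rw [Finset.card_insert_of_notMem fun h =>
          Finset.notMem_range_self (Finset.mem_powerset.1 hs h)]
        ring,
      Finset.sum_add_distrib, ih]
    simp only [Finset.sum_const, Finset.card_powerset, Finset.card_range, smul_eq_mul]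
    ring

lemma card_first_ascent_at_last (m : ℕ) :
    Nat.card {p : Fin (m + 2) → Fin (m + 2) // IsOSP p ∧
      (∃ a b : Fin (m + 2), a < b ∧ p a < p b) ∧
      ¬ ∃ a b : Fin (m + 2), a.val < m + 1 ∧ b.val < m + 1 ∧ a < b ∧ p a < p b} =
      (m + 1) * 2 ^ m := by
  let T : Finset (Σ _ : Finset ℕ, ℕ) :=
    (Finset.range m).powerset.sigma fun s => Finset.Icc 1 (2 * s.card + 1)
  let f : (Σ _ : Finset ℕ, ℕ) → Fin (m + 2) → Fin (m + 2) :=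
    fun x i => Fin.ofNat (m + 2) (insertLast m x.1 x.2 i)
  have hT : ∀ s h, (⟨s, h⟩ : Σ _ : Finset ℕ, ℕ) ∈ T ↔
      s ⊆ Finset.range m ∧ 1 ≤ h ∧ h ≤ 2 * s.card + 1 := by
    simp [T]
  have hf : ∀ s h, s ⊆ Finset.range m → h ≤ 2 * s.card + 1 → ∀ i,
      (f ⟨s, h⟩ i : ℕ) = insertLast m s h i := by
    intro s h hs hh i
    exact Nat.mod_eq_of_lt (Nat.lt_succ_of_le (insertLast_le hs hh i))
  have himage : {p : Fin (m + 2) → Fin (m + 2) | IsOSP p ∧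
      (∃ a b : Fin (m + 2), a < b ∧ p a < p b) ∧
      ¬ ∃ a b : Fin (m + 2), a.val < m + 1 ∧ b.val < m + 1 ∧ a < b ∧ p a < p b} =
      f '' (T : Set (Σ _ : Finset ℕ, ℕ)) := by
    ext p
    simp only [Set.mem_ofPred_eq, Set.mem_image, Finset.mem_coe]
    constructor
    · rintro ⟨hosp, ⟨a, b, hab, hlt⟩, hanti⟩
      push Not at hanti
      let q : ℕ → ℕ := fun i => p (Fin.ofNat (m + 2) i)
      have hqp : ∀ i : Fin (m + 2), q i = p i := fun i => by simp [q]
      have hb : b.val = m + 1 := by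
        by_contra hne
        exact hlt.not_ge (hanti a b (by omega) (by omega) hab)
      obtain ⟨s, hs, h, h1, hh, heq⟩ := exists_eq_insertLast (m := m) (q := q)
        (fun i hi v hv => by
          have e : q i = p ⟨i, by omega⟩ := hqp ⟨i, by omega⟩
          rw [e] at hv
          obtain ⟨k, hk⟩ := hosp ⟨i, by omega⟩ ⟨v, by omega⟩ hv
          exact ⟨k, by omega, by rw [hqp, hk]⟩)
        (by rw [← hb, hqp]; omega)
        (fun i k hik hk => by
          rcases hik.eq_or_lt with rfl | hik
          · rfl
          have e1 : q i = p ⟨i, by omega⟩ := hqp ⟨i, by omega⟩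
          have e2 : q k = p ⟨k, by omega⟩ := hqp ⟨k, by omega⟩
          rw [e1, e2]
          exact hanti ⟨i, by omega⟩ ⟨k, by omega⟩ (by simp only; omega) (by simp only; omega) hik)
      refine ⟨⟨s, h⟩, (hT s h).2 ⟨hs, h1, hh⟩, funext fun i => Fin.ext ?_⟩
      rw [hf s h hs hh, heq i (by omega), hqp]
    · rintro ⟨⟨s, h⟩, hx, rfl⟩
      obtain ⟨hs, h1, hh⟩ := (hT s h).1 hx
      refine ⟨fun i v hv => ?_, ⟨⟨m, by omega⟩, Fin.last (m + 1), ?_, ?_⟩, ?_⟩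
      · rw [Fin.le_def, hf s h hs hh] at hv
        obtain ⟨k, hk, hkv⟩ := exists_insertLast_eq hs hh hv
        exact ⟨⟨k, by omega⟩, Fin.ext ((hf s h hs hh _).trans hkv)⟩
      · simp [Fin.lt_def]
      · rw [Fin.lt_def, hf s h hs hh, hf s h hs hh]
        simp only [insertLast, Fin.val_last, descentsFrom_eq_zero hs le_rfl, if_true]
        split_ifs <;> omega
      · rintro ⟨a, b, -, hb, hab, hlt⟩
        rw [Fin.lt_def, hf s h hs hh, hf s h hs hh] at hlt
        exact hlt.not_ge (insertLast_antitone hab.le (by omega))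
  have hinj : Set.InjOn f (T : Set (Σ _ : Finset ℕ, ℕ)) := by
    rintro ⟨s, h⟩ hx ⟨s', h'⟩ hx' hff
    obtain ⟨hs, -, hh⟩ := (hT s h).1 hx
    obtain ⟨hs', -, hh'⟩ := (hT s' h').1 hx'
    obtain ⟨rfl, rfl⟩ := insertLast_inj hs hs' hh hh' fun i hi => by
      have := congrArg Fin.val (congrFun hff ⟨i, by omega⟩)
      rwa [hf s h hs hh, hf s' h' hs' hh'] at this
    rfl
  change Nat.card ↥{p : Fin (m + 2) → Fin (m + 2) | IsOSP p ∧
      (∃ a b : Fin (m + 2), a < b ∧ p a < p b) ∧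
      ¬ ∃ a b : Fin (m + 2), a.val < m + 1 ∧ b.val < m + 1 ∧ a < b ∧ p a < p b} = _
  rw [himage, Nat.card_coe_set_eq, hinj.ncard_image, Set.ncard_coe_finset,
    Finset.card_sigma, ← sum_powerset_two_mul_card_add_one]
  simp

/-- Stopping condition `x_i < x_j` (`i < j`): the number of leaves after `n` steps
equals `(n-1) · 2^(n-1) + 1`. -/
theorem woc_stop_lt (n : ℕ) (hn : 1 ≤ n) :
    Nat.card {p : Fin n → Fin n // IsOSP p ∧ ¬ ∃ i j : Fin n, i < j ∧ p i < p j} +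
      ∑ j ∈ Finset.Icc 1 n,
        Nat.card {p : Fin j → Fin j // IsOSP p ∧ (∃ a b : Fin j, a < b ∧ p a < p b) ∧
          ¬ ∃ a b : Fin j, a.val < j - 1 ∧ b.val < j - 1 ∧ a < b ∧ p a < p b}
      = (n - 1) * 2 ^ (n - 1) + 1 := by
  obtain ⟨m, rfl⟩ := Nat.exists_eq_add_of_le' hn
  rw [card_antitone_osp]
  simp only [Nat.add_sub_cancel]
  induction m with
  | zero =>
    simp only [zero_add, Finset.Icc_self, Finset.sum_singleton, pow_zero, zero_mul]
    rw [add_eq_left, Nat.card_eq_zero]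
    refine Or.inl ⟨fun ⟨p, _, ⟨a, b, hab, _⟩, _⟩ => ?_⟩
    omega
  | succ m ih =>
    rw [Finset.sum_Icc_succ_top (by omega)]
    have h := card_first_ascent_at_last m
    have ih := ih (by omega)
    simp only [Nat.add_sub_cancel] at h ⊢
    rw [show m + 1 + 1 = m + 2 from rfl, h, pow_succ]
    linarith
end

section
/- For every n ≥ 1, the number of leaves after n steps of the restricted generating tree of weak-ordering chains with stopping condition x_i ≤ x_j (i < j) equals n² − n + 1. -/
/- Deleting the element `n` from an ordered set partition of `[n]` preserves block
membership and the relative order of the blocks of the remaining elements, so the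
restriction to `[n-1]` contains a given stopping condition iff the condition occurs
with all of its witnesses among the elements of `[n-1]`, i.e. among the indices `i`
with `i.val < n - 1`. -/

/-- A strictly antitone self-map of `Fin m` is the reversal. -/
theorem StrictAnti.eq_rev {m : ℕ} {r : Fin m → Fin m} (hr : StrictAnti r) : r = Fin.rev := by
  have hmono : StrictMono (r ∘ Fin.rev) := fun a b h => hr (Fin.rev_lt_rev.2 h)
  have hid : r ∘ Fin.rev = id := (hmono.range_inj strictMono_id).1 (by
    rw [Set.range_id, Set.range_eq_univ]
    exact Finite.surjective_of_injective hmono.injective)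
  funext i
  simpa using congrFun hid i.rev

/-- A strictly antitone map `Fin m → Fin (m + 1)` lists all values but one in decreasing order. -/
theorem StrictAnti.exists_eq_succAbove_rev {m : ℕ} {q : Fin m → Fin (m + 1)}
    (hq : StrictAnti q) : ∃ w : Fin (m + 1), ∀ i, q i = w.succAbove i.rev := by
  have hns : ¬ Function.Surjective q := fun h => by
    have := Fintype.card_le_of_surjective q h
    simp at this
  obtain ⟨w, hw⟩ := not_forall.1 hns
  have hex : ∀ i, ∃ k, w.succAbove k = q i := fun i =>
    Fin.exists_succAbove_eq fun h => hw ⟨i, h⟩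
  choose r hr using hex
  have hanti : StrictAnti r := fun a b h => by
    have := hq h
    rwa [← hr, ← hr, Fin.succAbove_lt_succAbove_iff] at this
  exact ⟨w, fun i => by rw [← hr, hanti.eq_rev]⟩

/-- The map whose first `m` values are the elements of `Fin (m + 1)` other than `w` in decreasing
order, and whose last value is `v`. -/
def antitoneSnoc {m : ℕ} (w v : Fin (m + 1)) : Fin (m + 1) → Fin (m + 1) :=
  Fin.snoc (α := fun _ => Fin (m + 1)) (fun i => w.succAbove i.rev) v

@[simp]
theorem antitoneSnoc_castSucc {m : ℕ} (w v : Fin (m + 1)) (i : Fin m) :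
    antitoneSnoc w v i.castSucc = w.succAbove i.rev := by
  simp [antitoneSnoc]

@[simp]
theorem antitoneSnoc_last {m : ℕ} (w v : Fin (m + 1)) :
    antitoneSnoc w v (Fin.last m) = v := by
  simp [antitoneSnoc]

theorem antitoneSnoc_inj {m : ℕ} {w v w' v' : Fin (m + 1)} :
    antitoneSnoc w v = antitoneSnoc w' v' ↔ w = w' ∧ v = v' := by
  refine ⟨fun h => ⟨Fin.succAbove_left_injective ?_, ?_⟩, fun ⟨h, h'⟩ => by rw [h, h']⟩
  · funext i
    simpa using congrFun h i.rev.castSucc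
  · simpa using congrFun h (Fin.last m)

theorem exists_castSucc_antitoneSnoc_eq {m : ℕ} {w u : Fin (m + 1)} (v : Fin (m + 1))
    (h : u ≠ w) : ∃ i : Fin m, antitoneSnoc w v i.castSucc = u := by
  obtain ⟨i, hi⟩ := Fin.exists_succAbove_eq h
  exact ⟨i.rev, by simpa using hi⟩

theorem exists_eq_antitoneSnoc {m : ℕ} {p : Fin (m + 1) → Fin (m + 1)}
    (hp : ¬ ∃ a b : Fin (m + 1), a.val < m ∧ b.val < m ∧ a < b ∧ p a ≤ p b) :
    ∃ w v, p = antitoneSnoc w v := by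
  have hq : StrictAnti fun i : Fin m => p i.castSucc := fun a b h =>
    lt_of_not_ge fun hle => hp ⟨a.castSucc, b.castSucc, a.2, b.2, h, hle⟩
  obtain ⟨w, hw⟩ := hq.exists_eq_succAbove_rev
  refine ⟨w, p (Fin.last m), funext fun i => ?_⟩
  induction i using Fin.lastCases with
  | last => simp
  | cast i => simpa using hw i

theorem antitoneSnoc_not_exists_le {m : ℕ} (w v : Fin (m + 1)) :
    ¬ ∃ a b : Fin (m + 1), a.val < m ∧ b.val < m ∧ a < b ∧
      antitoneSnoc w v a ≤ antitoneSnoc w v b := by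
  rintro ⟨a, b, ha, hb, hab, hle⟩
  obtain ⟨a, rfl⟩ : ∃ a' : Fin m, a'.castSucc = a := ⟨⟨a, ha⟩, rfl⟩
  obtain ⟨b, rfl⟩ : ∃ b' : Fin m, b'.castSucc = b := ⟨⟨b, hb⟩, rfl⟩
  rw [antitoneSnoc_castSucc, antitoneSnoc_castSucc, Fin.succAbove_le_succAbove_iff,
    Fin.rev_le_rev] at hle
  exact absurd hab (not_lt.2 hle)

theorem isOSP_antitoneSnoc_iff {m : ℕ} {w v : Fin (m + 1)} :
    IsOSP (antitoneSnoc w v) ↔ v = w ∨ w = Fin.last m := by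
  constructor
  · intro h
    by_contra! hne
    obtain ⟨i, hi⟩ := exists_castSucc_antitoneSnoc_eq v hne.2.symm
    obtain ⟨j, hj⟩ := h i.castSucc w (hi ▸ Fin.le_last w)
    induction j using Fin.lastCases with
    | last => exact hne.1 (by simpa using hj)
    | cast j => simp at hj
  · intro h i u hu
    by_cases huw : u = w
    · subst huw
      rcases h with rfl | rfl
      · exact ⟨Fin.last m, antitoneSnoc_last _ _⟩
      · exact ⟨i, (Fin.last_le_iff.1 hu)⟩
    · obtain ⟨k, hk⟩ := exists_castSucc_antitoneSnoc_eq v huw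
      exact ⟨_, hk⟩

theorem antitoneSnoc_exists_le_iff {m : ℕ} {w v : Fin (m + 1)} (h : v = w ∨ w = Fin.last m) :
    (∃ a b : Fin (m + 1), a < b ∧ antitoneSnoc w v a ≤ antitoneSnoc w v b) ↔ w ≠ 0 := by
  constructor
  · rintro ⟨a, b, hab, hle⟩ rfl
    have ha : a.val < m := by omega
    obtain ⟨a, rfl⟩ : ∃ a' : Fin m, a'.castSucc = a := ⟨⟨a, ha⟩, rfl⟩
    have hm : m ≠ 0 := by rintro rfl; exact a.elim0
    have hv : v = 0 := h.resolve_right fun h0 => hm (by simpa using (congrArg Fin.val h0).symm)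
    induction b using Fin.lastCases with
    | last => simp [hv] at hle
    | cast b => exact antitoneSnoc_not_exists_le 0 v ⟨_, _, a.2, b.2, hab, hle⟩
  · intro hw
    obtain ⟨i, hi⟩ := exists_castSucc_antitoneSnoc_eq v hw.symm
    exact ⟨i.castSucc, Fin.last m, Fin.castSucc_lt_last i, hi ▸ Fin.zero_le _⟩

theorem card_isOSP_not_exists_le (n : ℕ) :
    Nat.card {p : Fin n → Fin n // IsOSP p ∧ ¬ ∃ i j : Fin n, i < j ∧ p i ≤ p j} = 1 := by
  rw [Nat.card_eq_one_iff_unique]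
  refine ⟨⟨fun p q => Subtype.ext ?_⟩, ⟨Fin.rev, fun _ v _ => ⟨v.rev, Fin.rev_rev v⟩, ?_⟩⟩
  · have hanti : ∀ p : {p : Fin n → Fin n // IsOSP p ∧ ¬ ∃ i j : Fin n, i < j ∧ p i ≤ p j},
        StrictAnti p.1 := fun p a b h => lt_of_not_ge fun hle => p.2.2 ⟨a, b, h, hle⟩
    rw [(hanti p).eq_rev, (hanti q).eq_rev]
  · rintro ⟨i, j, hij, hle⟩
    exact absurd hij (not_lt.2 (Fin.rev_le_rev.1 hle))

theorem card_isOSP_first_exists_le (m : ℕ) :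
    Nat.card {p : Fin (m + 1) → Fin (m + 1) // IsOSP p ∧
      (∃ a b : Fin (m + 1), a < b ∧ p a ≤ p b) ∧
      ¬ ∃ a b : Fin (m + 1), a.val < m ∧ b.val < m ∧ a < b ∧ p a ≤ p b} = 2 * m := by
  let f : Fin m ⊕ Fin m → Fin (m + 1) → Fin (m + 1) :=
    Sum.elim (fun w => antitoneSnoc w.succ w.succ)
      (fun v => antitoneSnoc (Fin.last m) v.castSucc)
  have hinj : Function.Injective f := by
    rintro (x | x) (y | y) h <;>
      simp only [f, Sum.elim_inl, Sum.elim_inr, antitoneSnoc_inj] at h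
    · rw [Fin.succ_injective m h.1]
    · exact absurd (h.2.symm.trans h.1) (Fin.castSucc_lt_last y).ne
    · exact absurd (h.2.trans h.1.symm) (Fin.castSucc_lt_last x).ne
    · rw [Fin.castSucc_injective m h.2]
  have hrange : ∀ p, (IsOSP p ∧ (∃ a b : Fin (m + 1), a < b ∧ p a ≤ p b) ∧
      ¬ ∃ a b : Fin (m + 1), a.val < m ∧ b.val < m ∧ a < b ∧ p a ≤ p b) ↔
      p ∈ Set.range f := by
    intro p
    constructor
    · rintro ⟨hosp, hex, hne⟩
      obtain ⟨w, v, rfl⟩ := exists_eq_antitoneSnoc hne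
      have h := isOSP_antitoneSnoc_iff.1 hosp
      have hw := (antitoneSnoc_exists_le_iff h).1 hex
      by_cases hvw : v = w
      · obtain ⟨x, rfl⟩ := Fin.exists_succ_eq.2 hw
        exact ⟨Sum.inl x, by simp [f, hvw]⟩
      · obtain rfl := h.resolve_left hvw
        obtain ⟨x, rfl⟩ := Fin.exists_castSucc_eq.2 hvw
        exact ⟨Sum.inr x, rfl⟩
    · rintro ⟨x | x, rfl⟩
      · exact ⟨isOSP_antitoneSnoc_iff.2 (Or.inl rfl),
          (antitoneSnoc_exists_le_iff (Or.inl rfl)).2 (Fin.succ_ne_zero x),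
          antitoneSnoc_not_exists_le _ _⟩
      · refine ⟨isOSP_antitoneSnoc_iff.2 (Or.inr rfl),
          (antitoneSnoc_exists_le_iff (Or.inr rfl)).2 fun h => ?_,
          antitoneSnoc_not_exists_le _ _⟩
        have := congrArg Fin.val h
        have := x.2
        simp_all
  rw [Nat.card_congr ((Equiv.subtypeEquivRight hrange).trans (Equiv.ofInjective f hinj).symm)]
  simp [two_mul]

/-- Stopping condition `x_i ≤ x_j` (`i < j`): the number of leaves after `n` steps
equals `n² - n + 1`. -/
theorem woc_stop_le (n : ℕ) (hn : 1 ≤ n) :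
    Nat.card {p : Fin n → Fin n // IsOSP p ∧ ¬ ∃ i j : Fin n, i < j ∧ p i ≤ p j} +
      ∑ j ∈ Finset.Icc 1 n,
        Nat.card {p : Fin j → Fin j // IsOSP p ∧ (∃ a b : Fin j, a < b ∧ p a ≤ p b) ∧
          ¬ ∃ a b : Fin j, a.val < j - 1 ∧ b.val < j - 1 ∧ a < b ∧ p a ≤ p b}
      = n ^ 2 - n + 1 := by
  rw [card_isOSP_not_exists_le]
  have hsum : ∀ k : ℕ, ∑ j ∈ Finset.Icc 1 k,
      Nat.card {p : Fin j → Fin j // IsOSP p ∧ (∃ a b : Fin j, a < b ∧ p a ≤ p b) ∧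
        ¬ ∃ a b : Fin j, a.val < j - 1 ∧ b.val < j - 1 ∧ a < b ∧ p a ≤ p b} = k ^ 2 - k := by
    intro k
    induction k with
    | zero => simp
    | succ m ih =>
      rw [Finset.sum_Icc_succ_top (Nat.le_add_left 1 m), ih]
      simp only [Nat.add_sub_cancel]
      rw [card_isOSP_first_exists_le]
      have h : m ≤ m ^ 2 := Nat.le_self_pow two_ne_zero m
      have h' : (m + 1) ^ 2 = m ^ 2 + 2 * m + 1 := by ring
      omega
  rw [hsum, add_comm]
end

section
/- For every n ≥ 1, the number of ordered set partitions of [n] that avoid the condition x_{i1} < x_{i2} < x_{i3} (i.e., there are no indices i1 < i2 < i3 with pos(i1) < pos(i2) < pos(i3)) equals Σ_{d=0}^{n−1} 2^d · e_{n,d}. -/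
/-- The number of descents of a permutation `σ` of `Fin n`:
positions `i` (0-based) with `σ (i+1) < σ i`. -/
noncomputable def descents {n : ℕ} (σ : Equiv.Perm (Fin n)) : ℕ :=
  Nat.card {q : Fin n × Fin n // q.1.val + 1 = q.2.val ∧ σ q.2 < σ q.1}

/-- `σ` contains the pattern 123. -/
def Contains123 {n : ℕ} (σ : Equiv.Perm (Fin n)) : Prop :=
  ∃ i j k : Fin n, i < j ∧ j < k ∧ σ i < σ j ∧ σ j < σ k

/-- `e123 n d` is the number of 123-avoiding permutations of `[n]` with exactly `d` descents. -/
noncomputable def e123 (n d : ℕ) : ℕ :=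
  Nat.card {σ : Equiv.Perm (Fin n) // ¬ Contains123 σ ∧ descents σ = d}

/-- The ordered set partition encoded by `p` contains the condition
`x_{i1} < x_{i2} < x_{i3}` with `i1 < i2 < i3`. -/
def Chain123 {n : ℕ} (p : Fin n → Fin n) : Prop :=
  ∃ i j k : Fin n, i < j ∧ j < k ∧ p i < p j ∧ p j < p k

/-- The word `σ` lists the blocks of `p` in order, each block in decreasing order. -/
def IsDecreasingListing {n : ℕ} (p : Fin n → Fin n) (σ : Equiv.Perm (Fin n)) : Prop :=
  ∀ a b, a < b → p (σ a) < p (σ b) ∨ p (σ a) = p (σ b) ∧ σ b < σ a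

lemma existsUnique_isDecreasingListing {n : ℕ} (p : Fin n → Fin n) :
    ∃! σ, IsDecreasingListing p σ := by
  let key : Fin n → Fin n ×ₗ (Fin n)ᵒᵈ := fun i => toLex (p i, OrderDual.toDual i)
  have key_inj : Function.Injective key := fun i j h =>
    OrderDual.toDual.injective (congrArg (fun x => (ofLex x).2) h)
  have listing_iff (σ : Equiv.Perm (Fin n)) :
      IsDecreasingListing p σ ↔ StrictMono (key ∘ σ) := by
    simp only [IsDecreasingListing, StrictMono, key, Function.comp, Prod.Lex.toLex_lt_toLex,
      OrderDual.toDual_lt_toDual]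
  refine ⟨Tuple.sort key, (listing_iff _).2 ?_, fun τ hτ => ?_⟩
  · exact (Tuple.monotone_sort key).strictMono_of_injective
      (key_inj.comp (Tuple.sort key).injective)
  · have h := Tuple.unique_monotone ((listing_iff τ).1 hτ).monotone (Tuple.monotone_sort key)
    exact Equiv.ext fun a => key_inj (congrFun h a)

namespace IsDecreasingListing

variable {n : ℕ} {p : Fin n → Fin n} {σ : Equiv.Perm (Fin n)}

lemma monotone (h : IsDecreasingListing p σ) : Monotone (p ∘ σ) := by
  intro a b hab
  rcases hab.eq_or_lt with rfl | hab
  · rfl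
  · rcases h a b hab with h | h
    · exact h.le
    · exact h.1.le

lemma symm_lt_symm (h : IsDecreasingListing p σ) {i j : Fin n} (hp : p i < p j) :
    σ.symm i < σ.symm j := by
  by_contra! hle
  have := h.monotone hle
  simp only [Function.comp, Equiv.apply_symm_apply] at this
  exact absurd hp this.not_gt

lemma lt_of_lt (h : IsDecreasingListing p σ) {a b : Fin n} (hab : a < b) (hσ : σ a < σ b) :
    p (σ a) < p (σ b) :=
  (h a b hab).resolve_right fun h' => absurd hσ h'.2.not_gt

lemma chain123_iff (h : IsDecreasingListing p σ) : Chain123 p ↔ Contains123 σ := by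
  constructor
  · rintro ⟨i, j, k, hij, hjk, pij, pjk⟩
    exact ⟨σ.symm i, σ.symm j, σ.symm k, h.symm_lt_symm pij, h.symm_lt_symm pjk,
      by simpa using hij, by simpa using hjk⟩
  · rintro ⟨a, b, c, hab, hbc, sab, sbc⟩
    exact ⟨σ a, σ b, σ c, sab, sbc, h.lt_of_lt hab sab, h.lt_of_lt hbc sbc⟩

end IsDecreasingListing

lemma descents_eq_card_succ_lt {m : ℕ} (σ : Equiv.Perm (Fin (m + 1))) :
    descents σ = Nat.card {i : Fin m // σ i.succ < σ i.castSucc} := by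
  symm
  refine Nat.card_eq_of_bijective
    (fun i => ⟨(i.1.castSucc, i.1.succ), by simp, i.2⟩) ⟨fun i j h => ?_, ?_⟩
  · simpa [Subtype.ext_iff] using h
  · rintro ⟨⟨a, b⟩, hab, hσ⟩
    obtain ⟨i, rfl⟩ : ∃ i : Fin m, a = i.castSucc := ⟨⟨a, by grind⟩, rfl⟩
    obtain rfl : b = i.succ := Fin.ext hab.symm
    exact ⟨⟨i, hσ⟩, rfl⟩

section Fiber

variable {m : ℕ} {p : Fin (m + 1) → Fin (m + 1)} {σ : Equiv.Perm (Fin (m + 1))}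

lemma IsOSP.apply_zero (hp : IsOSP p) (h : IsDecreasingListing p σ) : p (σ 0) = 0 := by
  obtain ⟨j, hj⟩ := hp (σ 0) 0 (Fin.zero_le _)
  have := h.monotone (Fin.zero_le (σ.symm j))
  simpa [hj] using this

lemma IsOSP.apply_succ_le (hp : IsOSP p) (h : IsDecreasingListing p σ) (i : Fin m) :
    (p (σ i.succ) : ℕ) ≤ p (σ i.castSucc) + 1 := by
  by_contra! hlt
  obtain ⟨j, hj⟩ := hp (σ i.succ) ⟨p (σ i.castSucc) + 1, by omega⟩ hlt.le
  rcases le_or_gt (σ.symm j) i.castSucc with hle | hgt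
  · have := h.monotone hle
    simp [hj, Fin.le_def] at this
  · have := h.monotone (Fin.castSucc_lt_iff_succ_le.1 hgt)
    simp only [Function.comp, Equiv.apply_symm_apply, hj, Fin.le_def] at this
    omega

lemma IsOSP.apply_succ_eq (hp : IsOSP p) (h : IsDecreasingListing p σ) (i : Fin m) :
    p (σ i.succ) = p (σ i.castSucc) ∧ σ i.succ < σ i.castSucc ∨
      (p (σ i.succ) : ℕ) = p (σ i.castSucc) + 1 := by
  have h₁ := hp.apply_succ_le h i
  rcases h _ _ (Fin.castSucc_lt_succ (i := i)) with h₂ | h₂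
  · exact Or.inr (by rw [Fin.lt_def] at h₂; omega)
  · exact Or.inl ⟨h₂.1.symm, h₂.2⟩

/-- The descents of `σ` at which no new block of `p` starts. -/
def mergedDescents (p : Fin (m + 1) → Fin (m + 1)) (σ : Equiv.Perm (Fin (m + 1))) :
    Set {i : Fin m // σ i.succ < σ i.castSucc} :=
  {i | p (σ i.1.succ) = p (σ i.1.castSucc)}

lemma eq_of_mergedDescents_eq {p' : Fin (m + 1) → Fin (m + 1)} (hp : IsOSP p) (hp' : IsOSP p')
    (h : IsDecreasingListing p σ) (h' : IsDecreasingListing p' σ)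
    (heq : mergedDescents p σ = mergedDescents p' σ) : p = p' := by
  have key (a : Fin (m + 1)) : p (σ a) = p' (σ a) := by
    induction a using Fin.induction with
    | zero => rw [hp.apply_zero h, hp'.apply_zero h']
    | succ i ih =>
      have hmem (hi : σ i.succ < σ i.castSucc) :
          p (σ i.succ) = p (σ i.castSucc) ↔ p' (σ i.succ) = p' (σ i.castSucc) :=
        Set.ext_iff.1 heq ⟨i, hi⟩
      rcases hp.apply_succ_eq h i with h₁ | h₁ <;> rcases hp'.apply_succ_eq h' i with h₂ | h₂
      · rw [h₁.1, h₂.1, ih]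
      · rw [(hmem h₁.2).1 h₁.1, h₁.1, ih]
      · rw [(hmem h₂.2).2 h₂.1, h₂.1, ih]
      · exact Fin.ext (by rw [h₁, h₂, ih])
  exact funext fun i => by simpa using key (σ.symm i)

lemma exists_le_sum_range_eq {c : ℕ → ℕ} (hc : ∀ i, c i ≤ 1) {v k : ℕ}
    (hv : v ≤ ∑ i ∈ Finset.range k, c i) : ∃ j ≤ k, ∑ i ∈ Finset.range j, c i = v := by
  induction k with
  | zero => exact ⟨0, le_rfl, by simp_all⟩
  | succ k ih =>
    rcases hv.eq_or_lt with rfl | hlt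
    · exact ⟨k + 1, le_rfl, rfl⟩
    · rw [Finset.sum_range_succ] at hlt
      obtain ⟨j, hj, hjv⟩ := ih (by have := hc k; omega)
      exact ⟨j, by omega, hjv⟩

open Classical in
lemma exists_mergedDescents_eq (S : Set {i : Fin m // σ i.succ < σ i.castSucc}) :
    ∃ p, IsOSP p ∧ IsDecreasingListing p σ ∧ mergedDescents p σ = S := by
  let c : ℕ → ℕ := fun i => if ∃ s ∈ S, s.1.val = i then 0 else 1
  let q : ℕ → ℕ := fun k => ∑ i ∈ Finset.range k, c i
  have hc (i : ℕ) : c i ≤ 1 := by dsimp only [c]; split_ifs <;> simp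
  have q_succ (k : ℕ) : q (k + 1) = q k + c k := Finset.sum_range_succ _ _
  have q_mono : Monotone q := monotone_nat_of_le_succ fun k => by rw [q_succ]; omega
  have q_le (k : ℕ) : q k ≤ k := by
    simpa using Finset.sum_le_sum (s := Finset.range k) fun i _ => hc i
  have eq_zero (i : ℕ) (hi : c i = 0) : ∃ s ∈ S, s.1.val = i := by
    by_contra hn
    simp only [c, if_neg hn, one_ne_zero] at hi
  let p : Fin (m + 1) → Fin (m + 1) := fun i =>
    ⟨q (σ.symm i), (q_le _).trans_lt (σ.symm i).isLt⟩
  have hpσ (a : Fin (m + 1)) : (p (σ a) : ℕ) = q a := by simp [p]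
  refine ⟨p, fun i v hv => ?_, fun a b hab => ?_, ?_⟩
  · obtain ⟨j, hj, hjv⟩ := exists_le_sum_range_eq hc (Fin.le_def.1 hv)
    exact ⟨σ ⟨j, hj.trans_lt (σ.symm i).isLt⟩, Fin.ext ((hpσ _).trans hjv)⟩
  · rcases (q_mono hab.le).lt_or_eq with hlt | heq
    · exact Or.inl (by rwa [Fin.lt_def, hpσ, hpσ])
    · refine Or.inr ⟨Fin.ext (by rw [hpσ, hpσ, heq]), ?_⟩
      have key (k : ℕ) (hk : k < m + 1) (hak : a < k) (hkb : k ≤ b) : σ ⟨k, hk⟩ < σ a := by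
        induction k with
        | zero => simp at hak
        | succ k ih =>
          have h₁ := q_mono (show (a : ℕ) ≤ k by omega)
          have h₂ := q_mono hkb
          have h₃ := q_succ k
          obtain ⟨s, -, hs⟩ := eq_zero k (by omega)
          have hstep : σ ⟨k + 1, hk⟩ < σ ⟨k, by omega⟩ := by
            subst hs
            exact s.2
          rcases (show (a : ℕ) ≤ k by omega).eq_or_lt with hak' | hak'
          · subst hak'
            exact hstep
          · exact hstep.trans (ih _ hak' (by omega))
      exact key b b.isLt hab le_rfl
  · ext s
    simp only [mergedDescents, Set.mem_ofPred_eq, Fin.ext_iff, hpσ, Fin.val_succ,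
      Fin.val_castSucc, q_succ]
    constructor
    · intro h
      obtain ⟨t, ht, hts⟩ := eq_zero s.1 (by omega)
      rwa [← Subtype.ext (Fin.ext hts)]
    · intro hs
      simp only [c, if_pos (show ∃ t ∈ S, t.1.val = s.1.val from ⟨s, hs, rfl⟩), add_zero]

lemma card_isOSP_listing (σ : Equiv.Perm (Fin (m + 1))) :
    Nat.card {p : Fin (m + 1) → Fin (m + 1) // IsOSP p ∧ IsDecreasingListing p σ} =
      2 ^ descents σ := by
  rw [Nat.card_eq_of_bijective (fun p => mergedDescents p.1 σ) ⟨?_, ?_⟩,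
    descents_eq_card_succ_lt]
  · classical
    rw [Nat.card_eq_fintype_card, Nat.card_eq_fintype_card, Fintype.card_set]
  · exact fun p p' h => Subtype.ext
      (eq_of_mergedDescents_eq p.2.1 p'.2.1 p.2.2 p'.2.2 h)
  · intro S
    obtain ⟨p, hp, h, hS⟩ := exists_mergedDescents_eq S
    exact ⟨⟨p, hp, h⟩, hS⟩

end Fiber

lemma descents_lt {m : ℕ} (σ : Equiv.Perm (Fin (m + 1))) : descents σ < m + 1 := by
  rw [descents_eq_card_succ_lt, Nat.lt_succ_iff]
  exact (Finite.card_subtype_le _).trans_eq (Nat.card_fin m)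

/-- The number of ordered set partitions of `[n]` avoiding the condition
`x_{i1} < x_{i2} < x_{i3}` equals `Σ_{d=0}^{n-1} 2^d · e_{n,d}`. -/
theorem woc_active_123 (n : ℕ) (hn : 1 ≤ n) :
    Nat.card {p : Fin n → Fin n // IsOSP p ∧ ¬ Chain123 p}
      = ∑ d ∈ Finset.range n, 2 ^ d * e123 n d := by
  classical
  obtain ⟨m, rfl⟩ : ∃ m, n = m + 1 := ⟨n - 1, by omega⟩
  choose L hL hL_unique using
    fun p : Fin (m + 1) → Fin (m + 1) => existsUnique_isDecreasingListing p
  have fiber (σ : Equiv.Perm (Fin (m + 1))) (hσ : ¬ Contains123 σ) :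
      {p ∈ ({p | IsOSP p ∧ ¬ Chain123 p} : Finset (Fin (m + 1) → Fin (m + 1))) |
          L p = σ}.card = 2 ^ descents σ := by
    rw [← card_isOSP_listing, Nat.card_eq_fintype_card, Fintype.card_subtype]
    congr 1
    ext p
    simp only [Finset.mem_filter, Finset.mem_univ, true_and]
    constructor
    · rintro ⟨⟨hp, -⟩, rfl⟩
      exact ⟨hp, hL p⟩
    · rintro ⟨hp, h⟩
      exact ⟨⟨hp, h.chain123_iff.not.2 hσ⟩, (hL_unique p σ h).symm⟩
  have maps : ∀ p ∈ ({p | IsOSP p ∧ ¬ Chain123 p} : Finset (Fin (m + 1) → Fin (m + 1))),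
      L p ∈ ({σ | ¬ Contains123 σ} : Finset (Equiv.Perm (Fin (m + 1)))) := fun p hp => by
    simp only [Finset.mem_filter, Finset.mem_univ, true_and] at hp ⊢
    exact (hL p).chain123_iff.not.1 hp.2
  rw [Nat.card_eq_fintype_card, Fintype.card_subtype, Finset.card_eq_sum_card_fiberwise maps,
    Finset.sum_congr rfl fun σ hσ => fiber σ (Finset.mem_filter.1 hσ).2,
    ← Finset.sum_fiberwise_of_maps_to (t := Finset.range (m + 1)) (g := descents)
      fun σ _ => Finset.mem_range.2 (descents_lt σ)]
  refine Finset.sum_congr rfl fun d _ => ?_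
  rw [Finset.sum_congr rfl fun σ hσ => by rw [(Finset.mem_filter.1 hσ).2], Finset.sum_const,
    smul_eq_mul, mul_comm, e123, Nat.card_eq_fintype_card, Fintype.card_subtype,
    Finset.filter_filter]
end

section
/- g_{3,0} = 1, and for every n > 3 and 1 ≤ d ≤ n − 3, g_{n,d} = (d+1)·e_{n−1,d} + (n−d)·e_{n−1,d−1} − e_{n,d}. -/
/-- The reduction of `σ` (obtained by deleting the largest entry from the
one-line notation of `σ`) avoids the pattern 123; equivalently, `σ` has no
occurrence of 123 using only entries different from the maximum value
(in an occurrence `σ i < σ j < σ k` only `σ k` can be the maximum). -/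
def ReductionAvoids123 {n : ℕ} (σ : Equiv.Perm (Fin n)) : Prop :=
  ¬ ∃ i j k : Fin n, i < j ∧ j < k ∧ σ i < σ j ∧ σ j < σ k ∧ ∃ l, σ k < σ l

/-- `g123 n d` is the number of permutations of `[n]` that contain the pattern 123,
have exactly `d` descents, and whose reduction (deleting the entry `n`) avoids 123. -/
noncomputable def g123 (n d : ℕ) : ℕ :=
  Nat.card {σ : Equiv.Perm (Fin n) //
    Contains123 σ ∧ descents σ = d ∧ ReductionAvoids123 σ}

/-- The number of indices `i < k` at which the sequence `f` descends. -/
def seqDescents (f : ℕ → ℕ) (k : ℕ) : ℕ :=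
  ∑ i ∈ Finset.range k, if f (i + 1) < f i then 1 else 0

/-- Inserting a new maximum before position `p` in the word `f 0, …, f k` keeps the
number of descents: either `p` is the end of the word, or the insertion splits a descent. -/
def KeepsDescents (f : ℕ → ℕ) (k p : ℕ) : Prop :=
  p = k + 1 ∨ (1 ≤ p ∧ p ≤ k ∧ f p < f (p - 1))

instance (f : ℕ → ℕ) (k p : ℕ) : Decidable (KeepsDescents f k p) := by
  unfold KeepsDescents; infer_instance

lemma seqDescents_insert_max (f g : ℕ → ℕ) (M p k : ℕ) (hp : p ≤ k + 1)
    (hlt : ∀ i < p, g i = f i) (hpM : g p = M) (hgt : ∀ i, p ≤ i → i ≤ k → g (i + 1) = f i)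
    (hM : ∀ i ≤ k, f i < M) :
    seqDescents g (k + 1) = seqDescents f k + if KeepsDescents f k p then 0 else 1 := by
  induction k with
  | zero =>
    obtain rfl | rfl : p = 0 ∨ p = 1 := by omega
    · have h1 := hgt 0 le_rfl le_rfl
      have h2 := hM 0 le_rfl
      rw [← h1, ← hpM] at h2
      simp [seqDescents, KeepsDescents, h2, -Finset.sum_boole]
    · have h1 := hlt 0 (by omega)
      have h2 := hM 0 le_rfl
      simp [seqDescents, KeepsDescents, h1, h2.le, hpM]
  | succ k ih =>
    rcases hp.eq_or_lt with rfl | hp'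
    · have h1 : seqDescents g (k + 1) = seqDescents f (k + 1) :=
        Finset.sum_congr rfl fun i hi => by
          have := Finset.mem_range.1 hi
          rw [hlt i (by omega), hlt (i + 1) (by omega)]
      have h2 := hM (k + 1) le_rfl
      rw [seqDescents, Finset.sum_range_succ, ← seqDescents, h1, hpM, hlt (k + 1) (by omega)]
      simp [KeepsDescents, h2.le]
    · have h := ih (by omega) (fun i h1 h2 => hgt i h1 (by omega)) (fun i hi => hM i (by omega))
      have h1 := hgt (k + 1) (by omega) le_rfl
      have h2 := hM (k + 1) le_rfl
      have h3 : seqDescents g (k + 1 + 1)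
          = seqDescents g (k + 1) + if g (k + 1 + 1) < g (k + 1) then 1 else 0 :=
        Finset.sum_range_succ _ _
      have h4 : seqDescents f (k + 1) = seqDescents f k + if f (k + 1) < f k then 1 else 0 :=
        Finset.sum_range_succ _ _
      rw [h3, h, h4, h1]
      rcases (Nat.le_of_lt_succ hp').eq_or_lt with rfl | hp''
      · rw [hpM]
        by_cases hd : f (k + 1) < f k <;> simp [KeepsDescents, h2, hd]
      · rw [hgt k (by omega) (by omega)]
        have : KeepsDescents f (k + 1) p ↔ KeepsDescents f k p := by
          unfold KeepsDescents
          constructor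
          · rintro (h | ⟨h1, h2, h3⟩)
            · omega
            · by_cases hpk : p = k + 1
              · exact Or.inl hpk
              · exact Or.inr ⟨h1, by omega, h3⟩
          · rintro (h | ⟨h1, h2, h3⟩)
            · omega
            · exact Or.inr ⟨h1, by omega, h3⟩
        simp only [this]
        omega

lemma card_keepsDescents (f : ℕ → ℕ) (k : ℕ) :
    ((Finset.range (k + 2)).filter (KeepsDescents f k)).card = seqDescents f k + 1 := by
  rw [Finset.card_filter, Finset.sum_range_succ, Finset.sum_range_succ']
  have h0 : ¬ KeepsDescents f k 0 := by simp [KeepsDescents]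
  have h1 : KeepsDescents f k (k + 1) := Or.inl rfl
  simp only [h0, h1, if_true, if_false, add_zero, add_left_inj]
  refine Finset.sum_congr rfl fun i hi => ?_
  have := Finset.mem_range.1 hi
  have h : KeepsDescents f k (i + 1) ↔ f (i + 1) < f i := by
    simp only [KeepsDescents, Nat.add_sub_cancel]
    omega
  simp [h]

/-- The one-line notation of `σ`, as a sequence extended by zeros. -/
def word {n : ℕ} (σ : Equiv.Perm (Fin n)) (i : ℕ) : ℕ :=
  if h : i < n then (σ ⟨i, h⟩).val else 0

lemma word_val {n : ℕ} (σ : Equiv.Perm (Fin n)) (i : Fin n) : word σ i.val = (σ i).val := by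
  simp [word]

lemma descents_eq_seqDescents {k : ℕ} (σ : Equiv.Perm (Fin (k + 1))) :
    descents σ = seqDescents (word σ) k := by
  classical
  rw [descents, seqDescents, ← Finset.card_filter, Nat.card_eq_fintype_card, Fintype.card_subtype]
  refine Finset.card_bij (fun q _ => q.1.val) ?_ ?_ ?_
  · rintro ⟨a, b⟩ h
    simp only [Finset.mem_filter, Finset.mem_univ, true_and, Finset.mem_range] at h ⊢
    refine ⟨by omega, ?_⟩
    rw [h.1, word_val, word_val]
    exact h.2
  · rintro ⟨a, b⟩ h ⟨a', b'⟩ h' hab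
    simp only [Finset.mem_filter, Finset.mem_univ, true_and] at h h' hab
    simp only [Prod.mk.injEq, Fin.ext_iff]
    omega
  · intro i hi
    simp only [Finset.mem_filter, Finset.mem_range] at hi
    refine ⟨(⟨i, by omega⟩, ⟨i + 1, by omega⟩), ?_, rfl⟩
    simp only [Finset.mem_filter, Finset.mem_univ, true_and]
    have h := hi.2
    rw [word, word, dif_pos (by omega), dif_pos (by omega)] at h
    exact h

/-- The permutation obtained from `τ` by inserting a new largest entry at position `p`. -/
def insertMax {m : ℕ} (p : Fin (m + 1)) (τ : Equiv.Perm (Fin m)) : Equiv.Perm (Fin (m + 1)) :=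
  ((finSuccEquiv' p).trans (Equiv.optionCongr τ)).trans (finSuccEquiv' (Fin.last m)).symm

@[simp] lemma insertMax_self {m : ℕ} (p : Fin (m + 1)) (τ : Equiv.Perm (Fin m)) :
    insertMax p τ p = Fin.last m := by
  simp [insertMax]

@[simp] lemma insertMax_succAbove {m : ℕ} (p : Fin (m + 1)) (τ : Equiv.Perm (Fin m)) (i : Fin m) :
    insertMax p τ (p.succAbove i) = (τ i).castSucc := by
  simp [insertMax]

lemma insertMax_bijective (m : ℕ) :
    Function.Bijective fun x : Fin (m + 1) × Equiv.Perm (Fin m) => insertMax x.1 x.2 := by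
  rw [Fintype.bijective_iff_injective_and_card]
  constructor
  · rintro ⟨p, τ⟩ ⟨p', τ'⟩ h
    have h : insertMax p τ = insertMax p' τ' := h
    obtain rfl : p = p' := (insertMax p τ).injective <| by
      rw [insertMax_self, h, insertMax_self]
    congr 1
    ext i : 1
    apply Fin.castSucc_injective
    rw [← insertMax_succAbove p, h, insertMax_succAbove]
  · simp [Fintype.card_perm, Nat.factorial_succ]

lemma reductionAvoids123_insertMax {m : ℕ} (p : Fin (m + 1)) (τ : Equiv.Perm (Fin m)) :
    ReductionAvoids123 (insertMax p τ) ↔ ¬ Contains123 τ := by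
  refine not_congr ⟨?_, ?_⟩
  · rintro ⟨i, j, k, hij, hjk, h1, h2, l, h3⟩
    have key : ∀ x, insertMax p τ x < insertMax p τ l → ∃ y, p.succAbove y = x := fun x hx =>
      Fin.exists_succAbove_eq fun h => by
        rw [h, insertMax_self] at hx
        exact absurd (Fin.le_last _) hx.not_ge
    obtain ⟨i, rfl⟩ := key i (h1.trans (h2.trans h3))
    obtain ⟨j, rfl⟩ := key j (h2.trans h3)
    obtain ⟨k, rfl⟩ := key k h3
    simp only [insertMax_succAbove, Fin.castSucc_lt_castSucc_iff,
      Fin.succAbove_lt_succAbove_iff] at *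
    exact ⟨i, j, k, hij, hjk, h1, h2⟩
  · rintro ⟨i, j, k, hij, hjk, h1, h2⟩
    refine ⟨p.succAbove i, p.succAbove j, p.succAbove k, ?_, ?_, ?_, ?_, p, ?_⟩ <;>
      simp [*, Fin.castSucc_lt_last]

lemma descents_insertMax {k : ℕ} (p : Fin (k + 2)) (τ : Equiv.Perm (Fin (k + 1))) :
    descents (insertMax p τ)
      = descents τ + if KeepsDescents (word τ) k p.val then 0 else 1 := by
  rw [descents_eq_seqDescents, descents_eq_seqDescents]
  apply seqDescents_insert_max (M := k + 1)
  · omega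
  · intro i hi
    have h : i < k + 1 := by omega
    have := word_val (insertMax p τ) (p.succAbove ⟨i, h⟩)
    rw [insertMax_succAbove, Fin.succAbove_of_castSucc_lt _ _ (by simpa [Fin.lt_def])] at this
    simpa [word, h] using this
  · simp [word_val]
  · intro i hi hk
    have h : i < k + 1 := by omega
    have := word_val (insertMax p τ) (p.succAbove ⟨i, h⟩)
    rw [insertMax_succAbove, Fin.succAbove_of_le_castSucc _ _ (by simpa [Fin.le_def])] at this
    simpa [word, h] using this
  · intro i hi
    rw [word, dif_pos (by omega)]
    exact Fin.is_lt _

lemma card_keepsDescents_fin {k : ℕ} (τ : Equiv.Perm (Fin (k + 1))) :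
    (Finset.univ.filter fun p : Fin (k + 2) => KeepsDescents (word τ) k p.val).card
      = descents τ + 1 := by
  rw [descents_eq_seqDescents, ← card_keepsDescents, Finset.card_filter, Finset.card_filter,
    Finset.sum_range]

lemma card_descents_insertMax {k d : ℕ} (τ : Equiv.Perm (Fin (k + 1))) :
    ((Finset.univ.filter fun p => descents (insertMax p τ) = d + 1).card : ℤ)
      = (if descents τ = d + 1 then (d + 2 : ℤ) else 0)
        + if descents τ = d then (k + 1 - d : ℤ) else 0 := by
  have h := card_keepsDescents_fin τ
  have hc := Finset.card_filter_add_card_filter_not (s := Finset.univ)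
    fun p : Fin (k + 2) => KeepsDescents (word τ) k p.val
  rw [h, Finset.card_univ, Fintype.card_fin] at hc
  have hiff (p : Fin (k + 2)) : descents (insertMax p τ) = d + 1 ↔
      (descents τ = d + 1 ∧ KeepsDescents (word τ) k p.val) ∨
        (descents τ = d ∧ ¬ KeepsDescents (word τ) k p.val) := by
    rw [descents_insertMax]
    split_ifs with hK <;> simp [hK]
  simp only [hiff]
  by_cases h1 : descents τ = d + 1
  · simp [h1, h]
    ring
  · by_cases h2 : descents τ = d
    · have h3 : ((Finset.univ.filter fun p : Fin (k + 2) =>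
          ¬ KeepsDescents (word τ) k p.val).card : ℤ) = k + 1 - d := by omega
      simpa [h2] using h3
    · simp [h1, h2]

/-- Permutations whose reduction avoids 123, counted by inserting the maximum into
the reduction. -/
lemma card_reductionAvoids123 (k d : ℕ) :
    (Nat.card {σ : Equiv.Perm (Fin (k + 2)) // ReductionAvoids123 σ ∧ descents σ = d + 1} : ℤ)
      = (d + 2) * e123 (k + 1) (d + 1) + (k + 1 - d) * e123 (k + 1) d := by
  classical
  have hcard : Nat.card {σ : Equiv.Perm (Fin (k + 2)) // ReductionAvoids123 σ ∧ descents σ = d + 1}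
      = Nat.card {x : Fin (k + 2) × Equiv.Perm (Fin (k + 1)) //
          ¬ Contains123 x.2 ∧ descents (insertMax x.1 x.2) = d + 1} :=
    (Nat.card_congr <| (Equiv.ofBijective _ (insertMax_bijective (k + 1))).subtypeEquiv
      fun x => by simp [reductionAvoids123_insertMax]).symm
  rw [hcard, e123, e123]
  simp only [Nat.card_eq_fintype_card, Fintype.card_subtype, Finset.card_filter,
    Fintype.sum_prod_type_right, Nat.cast_sum, Finset.mul_sum, ← Finset.sum_add_distrib]
  refine Finset.sum_congr rfl fun τ _ => ?_
  by_cases hτ : Contains123 τ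
  · simp [hτ]
  · have := card_descents_insertMax (d := d) τ
    rw [Finset.card_filter, Nat.cast_sum] at this
    simpa [hτ] using this

lemma g123_add_e123 (n d : ℕ) :
    g123 n d + e123 n d
      = Nat.card {σ : Equiv.Perm (Fin n) // ReductionAvoids123 σ ∧ descents σ = d} := by
  classical
  simp only [g123, e123, Nat.card_eq_fintype_card, Fintype.card_subtype]
  rw [← Finset.card_union_of_disjoint]
  · congr 1
    ext σ
    have : ¬ Contains123 σ → ReductionAvoids123 σ := fun h ⟨i, j, k, h1, h2, h3, h4, _⟩ =>
      h ⟨i, j, k, h1, h2, h3, h4⟩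
    simp only [Finset.mem_union, Finset.mem_filter, Finset.mem_univ, true_and]
    tauto
  · rw [Finset.disjoint_filter]
    tauto

lemma g123_three_zero : g123 3 0 = 1 := by
  rw [g123, Nat.card_eq_one_iff_unique]
  have hid : ∀ σ : Equiv.Perm (Fin 3), seqDescents (word σ) 2 = 0 → σ = 1 := by decide
  refine ⟨⟨fun ⟨σ, _, hσ, _⟩ ⟨τ, _, hτ, _⟩ => Subtype.ext ?_⟩,
    ⟨1, ⟨0, 1, 2, by decide⟩, ?_, ?_⟩⟩
  · rw [descents_eq_seqDescents] at hσ hτ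
    exact (hid σ hσ).trans (hid τ hτ).symm
  · rw [descents_eq_seqDescents]
    decide
  · rw [ReductionAvoids123]
    decide

/-- `g_{3,0} = 1`, and for `n > 3` and `1 ≤ d ≤ n - 3`,
`g_{n,d} = (d+1)·e_{n-1,d} + (n-d)·e_{n-1,d-1} - e_{n,d}`. -/
theorem g123_recurrence :
    g123 3 0 = 1 ∧
    ∀ n d : ℕ, 3 < n → 1 ≤ d → d ≤ n - 3 →
      (g123 n d : ℤ)
        = (d + 1) * e123 (n - 1) d + ((n : ℤ) - d) * e123 (n - 1) (d - 1) - e123 n d := by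
  refine ⟨g123_three_zero, fun n d hn hd _ => ?_⟩
  obtain ⟨k, rfl⟩ : ∃ k, n = k + 2 := ⟨n - 2, by omega⟩
  obtain ⟨d, rfl⟩ : ∃ c, d = c + 1 := ⟨d - 1, by omega⟩
  have h := card_reductionAvoids123 k d
  rw [← g123_add_e123] at h
  simp only [Nat.add_sub_cancel, show k + 2 - 1 = k + 1 from rfl]
  push_cast at h ⊢
  linarith
end

section
/- For every n ≥ 1, the number of ordered set partitions of [n] that avoid the condition x_{i1} ≤ x_{i2} ≤ x_{i3} (i.e., there are no indices i1 < i2 < i3 with pos(i1) ≤ pos(i2) ≤ pos(i3)) equals Σ_{d=0}^{n−1} 2^{n−1−d} · e_{n,d}. -/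
/-- The ordered set partition encoded by `p` contains the condition
`x_{i1} ≤ x_{i2} ≤ x_{i3}` with `i1 < i2 < i3`. -/
def ChainLeLe {n : ℕ} (p : Fin n → Fin n) : Prop :=
  ∃ i j k : Fin n, i < j ∧ j < k ∧ p i ≤ p j ∧ p j ≤ p k

open Finset in
/-- The descent positions of a permutation of `Fin (m + 1)`, indexed by `Fin m`. -/
def descentSet {m : ℕ} (τ : Equiv.Perm (Fin (m + 1))) : Finset (Fin m) :=
  univ.filter fun i => τ i.succ < τ i.castSucc

open Finset in
/-- The positions at which a function on `Fin (m + 1)` strictly increases. -/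
def ascentSet {m : ℕ} (q : Fin (m + 1) → Fin (m + 1)) : Finset (Fin m) :=
  univ.filter fun i => q i.castSucc < q i.succ

open Finset in
/-- The function that starts at `0` and increases by one exactly at the positions in `S`. -/
def stepFun {m : ℕ} (S : Finset (Fin m)) (i : Fin (m + 1)) : Fin (m + 1) :=
  ⟨(S.filter fun s => s.castSucc < i).card,
    Nat.lt_succ_of_le ((card_le_univ _).trans_eq (Fintype.card_fin m))⟩

theorem descents_eq_card_descentSet {m : ℕ} (τ : Equiv.Perm (Fin (m + 1))) :
    descents τ = (descentSet τ).card := by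
  rw [descents, ← Nat.card_eq_finsetCard]
  symm
  refine Nat.card_eq_of_bijective
    (fun i => ⟨(i.1.castSucc, i.1.succ), by simp, by simpa [descentSet] using i.2⟩) ⟨?_, ?_⟩
  · rintro ⟨i, hi⟩ ⟨j, hj⟩ h
    simpa using h
  · rintro ⟨⟨a, b⟩, h, hlt⟩
    have ha : a.val < m := by have := b.isLt; simp only at h; omega
    have h1 : (⟨a.val, ha⟩ : Fin m).castSucc = a := rfl
    have h2 : (⟨a.val, ha⟩ : Fin m).succ = b := Fin.ext h
    refine ⟨⟨⟨a.val, ha⟩, ?_⟩, ?_⟩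
    · simpa [descentSet, h1, h2] using hlt
    · simp [h2]

theorem stepFun_zero {m : ℕ} (S : Finset (Fin m)) : stepFun S 0 = 0 := by
  simp [stepFun]

theorem stepFun_succ {m : ℕ} (S : Finset (Fin m)) (i : Fin m) :
    (stepFun S i.succ).val = (stepFun S i.castSucc).val + if i ∈ S then 1 else 0 := by
  simp only [stepFun, Fin.castSucc_lt_succ_iff, Fin.castSucc_lt_castSucc_iff]
  split_ifs with h
  · rw [← Finset.card_insert_of_notMem (a := i) (by simp)]
    congr 1
    ext s
    simp only [Finset.mem_filter, Finset.mem_insert, le_iff_eq_or_lt]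
    grind
  · congr 1
    ext s
    simp only [Finset.mem_filter, le_iff_eq_or_lt]
    grind

theorem stepFun_monotone {m : ℕ} (S : Finset (Fin m)) : Monotone (stepFun S) :=
  Fin.monotone_iff_le_succ.2 fun i => by
    rw [Fin.le_def, stepFun_succ]
    omega

theorem ascentSet_stepFun {m : ℕ} (S : Finset (Fin m)) : ascentSet (stepFun S) = S := by
  ext i
  have := stepFun_succ S i
  simp only [ascentSet, Finset.mem_filter, Finset.mem_univ, true_and, Fin.lt_def]
  split_ifs at this with h <;> simp [h] <;> omega

theorem isOSP_stepFun {m : ℕ} (S : Finset (Fin m)) : IsOSP (stepFun S) := by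
  intro i
  induction i using Fin.induction with
  | zero =>
    intro v hv
    exact ⟨0, (le_antisymm hv (by simp [stepFun_zero])).symm⟩
  | succ i ih =>
    intro v hv
    by_cases h : v ≤ stepFun S i.castSucc
    · exact ih v h
    · refine ⟨i.succ, ?_⟩
      have := stepFun_succ S i
      rw [Fin.le_def] at h hv
      apply Fin.ext
      split_ifs at this <;> omega

theorem stepFun_ascentSet {m : ℕ} {q : Fin (m + 1) → Fin (m + 1)} (hq : Monotone q)
    (hosp : IsOSP q) : stepFun (ascentSet q) = q := by
  funext i
  induction i using Fin.induction with
  | zero =>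
    obtain ⟨j, hj⟩ := hosp 0 0 (Fin.zero_le _)
    rw [stepFun_zero]
    exact le_antisymm (Fin.zero_le _) ((hq (Fin.zero_le j)).trans hj.le)
  | succ i ih =>
    have hle : q i.castSucc ≤ q i.succ := hq (Fin.castSucc_lt_succ (i := i)).le
    have hub : (q i.succ).val ≤ (q i.castSucc).val + 1 := by
      by_contra! hlt
      obtain ⟨j, hj⟩ := hosp i.succ ⟨(q i.castSucc).val + 1, hlt.trans (q i.succ).isLt⟩ hlt.le
      have hj' : (q j).val = (q i.castSucc).val + 1 := by rw [hj]
      rcases le_or_gt j i.castSucc with h | h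
      · have := Fin.le_def.1 (hq h)
        omega
      · have := Fin.le_def.1 (hq (Fin.castSucc_lt_iff_succ_le.1 h))
        omega
    apply Fin.ext
    rw [stepFun_succ, ih]
    simp only [ascentSet, Finset.mem_filter, Finset.mem_univ, true_and, Fin.lt_def]
    rw [Fin.le_def] at hle
    split_ifs <;> omega

theorem isOSP_comp_equiv {n : ℕ} {p : Fin n → Fin n} (σ : Equiv.Perm (Fin n)) (hp : IsOSP p) :
    IsOSP (p ∘ σ) := fun i v hv => by
  obtain ⟨j, hj⟩ := hp (σ i) v hv
  exact ⟨σ.symm j, by simpa using hj⟩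

theorem eq_sort_iff_descentSet_subset {m : ℕ} {p : Fin (m + 1) → Fin (m + 1)}
    {τ : Equiv.Perm (Fin (m + 1))} :
    τ = Tuple.sort p ↔ Monotone (p ∘ τ) ∧ descentSet τ ⊆ ascentSet (p ∘ τ) := by
  rw [Tuple.eq_sort_iff]
  refine and_congr_right fun hmono => ⟨fun h i hi => ?_, fun h => ?_⟩
  · simp only [descentSet, ascentSet, Finset.mem_filter, Finset.mem_univ, true_and] at hi ⊢
    have hlt := Fin.castSucc_lt_succ (i := i)
    exact lt_of_le_of_ne (hmono hlt.le) fun he => (h _ _ hlt he).asymm hi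
  · intro i j
    induction j using Fin.induction with
    | zero => intro hi; exact absurd hi (Fin.not_lt_zero i)
    | succ j ih =>
      intro hij he
      have hij' : i ≤ j.castSucc := Fin.le_castSucc_iff.2 hij
      have h1 : p (τ i) ≤ p (τ j.castSucc) := hmono hij'
      have h2 : p (τ j.castSucc) ≤ p (τ j.succ) := hmono (Fin.castSucc_lt_succ (i := j)).le
      have h3 : τ j.castSucc < τ j.succ := by
        by_contra! hle
        have hne : τ j.succ ≠ τ j.castSucc :=
          τ.injective.ne (Fin.castSucc_lt_succ (i := j)).ne'
        have hj := @h j (by simpa [descentSet] using lt_of_le_of_ne hle hne)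
        simp only [ascentSet, Finset.mem_filter, Finset.mem_univ, true_and,
          Function.comp_apply] at hj
        exact (h1.trans_lt hj).ne he
      rcases hij'.eq_or_lt with rfl | hlt
      · exact h3
      · exact (ih hlt (le_antisymm h1 (he ▸ h2))).trans h3

theorem chainLeLe_iff_contains123_sort {n : ℕ} (p : Fin n → Fin n) :
    ChainLeLe p ↔ Contains123 (Tuple.sort p) := by
  obtain ⟨hmono, hstable⟩ := Tuple.eq_sort_iff.1 (rfl : Tuple.sort p = Tuple.sort p)
  set τ := Tuple.sort p
  have key : ∀ a b, τ a < τ b → p (τ a) ≤ p (τ b) → a < b := by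
    intro a b hlt hle
    by_contra! hba
    have hba' : b < a := lt_of_le_of_ne hba (by rintro rfl; exact hlt.false)
    exact (hstable b a hba' (le_antisymm (hmono hba) hle)).asymm hlt
  constructor
  · rintro ⟨i, j, k, hij, hjk, h1, h2⟩
    obtain ⟨a, rfl⟩ := τ.surjective i
    obtain ⟨b, rfl⟩ := τ.surjective j
    obtain ⟨c, rfl⟩ := τ.surjective k
    exact ⟨a, b, c, key a b hij h1, key b c hjk h2, hij, hjk⟩
  · rintro ⟨a, b, c, hab, hbc, h1, h2⟩
    exact ⟨τ a, τ b, τ c, h1, h2, hmono hab.le, hmono hbc.le⟩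

open Finset Classical in
theorem card_isOSP_sort_eq {m : ℕ} (τ : Equiv.Perm (Fin (m + 1))) :
    (univ.filter fun p : Fin (m + 1) → Fin (m + 1) => IsOSP p ∧ Tuple.sort p = τ).card
      = 2 ^ (m - descents τ) := by
  have hcard : (Icc (descentSet τ) univ).card = 2 ^ (m - descents τ) := by
    rw [card_Icc_finset (subset_univ _), descents_eq_card_descentSet, card_univ, Fintype.card_fin]
  rw [← hcard]
  refine card_nbij' (fun p => ascentSet (p ∘ τ)) (fun S => stepFun S ∘ τ.symm) ?_ ?_ ?_ ?_
  · intro p hp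
    simp only [coe_filter, mem_univ, true_and, Set.mem_ofPred_eq] at hp
    simpa using (eq_sort_iff_descentSet_subset.1 hp.2.symm).2
  · intro S hS
    have hcomp : (stepFun S ∘ τ.symm) ∘ τ = stepFun S := by ext; simp
    simp only [coe_filter, mem_univ, true_and, Set.mem_ofPred_eq]
    refine ⟨isOSP_comp_equiv _ (isOSP_stepFun S), (eq_sort_iff_descentSet_subset.2 ?_).symm⟩
    rw [hcomp, ascentSet_stepFun]
    exact ⟨stepFun_monotone S, by simpa using hS⟩
  · intro p hp
    simp only [coe_filter, mem_univ, true_and, Set.mem_ofPred_eq] at hp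
    simp only
    rw [stepFun_ascentSet (eq_sort_iff_descentSet_subset.1 hp.2.symm).1
      (isOSP_comp_equiv τ hp.1)]
    ext; simp
  · intro S _
    have hcomp : (stepFun S ∘ τ.symm) ∘ τ = stepFun S := by ext; simp
    simp only [hcomp, ascentSet_stepFun]

/-- The number of ordered set partitions of `[n]` avoiding the condition
`x_{i1} ≤ x_{i2} ≤ x_{i3}` equals `Σ_{d=0}^{n-1} 2^(n-1-d) · e_{n,d}`. -/
theorem woc_active_lele (n : ℕ) (hn : 1 ≤ n) :
    Nat.card {p : Fin n → Fin n // IsOSP p ∧ ¬ ChainLeLe p}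
      = ∑ d ∈ Finset.range n, 2 ^ (n - 1 - d) * e123 n d := by
  classical
  obtain ⟨m, rfl⟩ := Nat.exists_eq_add_of_le' hn
  rw [Nat.card_eq_fintype_card, Fintype.card_subtype,
    Finset.card_eq_sum_card_fiberwise (f := Tuple.sort)
      (t := Finset.univ.filter fun τ : Equiv.Perm (Fin (m + 1)) => ¬ Contains123 τ)
      (fun p hp => by simpa [← chainLeLe_iff_contains123_sort] using (by simpa using hp :
        IsOSP p ∧ ¬ ChainLeLe p).2),
    ← Finset.sum_fiberwise_of_maps_to (g := descents) (t := Finset.range (m + 1)) (fun τ _ => by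
      rw [Finset.mem_range, descents_eq_card_descentSet]
      exact Nat.lt_succ_of_le ((Finset.card_le_univ _).trans_eq (Fintype.card_fin m)))]
  refine Finset.sum_congr rfl fun d _ => ?_
  rw [e123, Nat.card_eq_fintype_card, Fintype.card_subtype, Finset.filter_filter, mul_comm,
    ← smul_eq_mul]
  refine Finset.sum_eq_card_nsmul fun τ hτ => ?_
  obtain ⟨hτ, rfl⟩ := (Finset.mem_filter.1 hτ).2
  rw [Finset.filter_filter, Nat.add_sub_cancel, ← card_isOSP_sort_eq]
  congr 1
  refine Finset.filter_congr fun p _ => ?_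
  rw [chainLeLe_iff_contains123_sort]
  grind
end

section
/- For every n ≥ 1, the number of ordered set partitions of [n] that avoid the condition x_{i1} ≤ x_{i2} ≤ x_{i3} (i.e., there are no indices i1 < i2 < i3 with pos(i1) ≤ pos(i2) ≤ pos(i3)) equals Σ_{j=0}^{⌊n/2⌋} binom(n−j, j) · C_{n−j}, where C_m denotes the m-th Catalan number. -/
open Polynomial

/-- No weakly increasing triple of letters. -/
def WeakChainFree (w : List ℕ) : Prop :=
  w.Triplewise fun x y z => x ≤ y → z < y

/-- The length of the longest strictly decreasing prefix. -/
def decPrefix : List ℕ → ℕ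
  | [] => 0
  | [_] => 1
  | a :: b :: t => if b < a then decPrefix (b :: t) + 1 else 1

/-- Insert the letter `m` after the first `r` letters. -/
def insertOne (m : ℕ) (w : List ℕ) (r : ℕ) : List ℕ :=
  w.take r ++ m :: w.drop r

/-- Insert the letter `m` at the front and after the first `r` letters. -/
def insertTwo (m : ℕ) (w : List ℕ) (r : ℕ) : List ℕ :=
  m :: insertOne m w r

/-- The chain-free words obtained from `w` by inserting one or two copies of a new maximum `m`. -/
def children (m : ℕ) (w : List ℕ) : Finset (List ℕ) :=
  (Finset.range (decPrefix w + 1)).image (insertOne m w) ∪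
    (Finset.range (decPrefix w + 1)).image (insertTwo m w)

/-- The chain-free words whose set of letters is `{0, …, m - 1}`. -/
def chainFreeWords : ℕ → Finset (List ℕ)
  | 0 => {[]}
  | m + 1 => (chainFreeWords m).biUnion (children m)

/-- The number of nodes at depth `d` below a node labelled `k` in the Catalan tree. -/
def catalanTree : ℕ → ℕ → ℕ
  | 0, _ => 1
  | d + 1, k => ∑ r ∈ Finset.range (k + 1), catalanTree d (r + 1)

theorem le_decPrefix_iff (w : List ℕ) (r : ℕ) :
    r ≤ decPrefix w ↔ r ≤ w.length ∧ (w.take r).Pairwise (· > ·) := by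
  induction w generalizing r with
  | nil => simp [decPrefix]
  | cons a t ih =>
    rcases r with _ | r
    · simp
    cases t with
    | nil => simp [decPrefix]
    | cons b t =>
      rw [decPrefix]
      split_ifs with h
      · rw [Nat.succ_le_succ_iff, ih, List.take_succ_cons, List.pairwise_cons]
        simp only [List.length_cons, Nat.succ_le_succ_iff]
        rcases r with _ | r
        · simp
        · simp only [List.take_succ_cons, List.pairwise_cons, List.mem_cons]
          constructor
          · rintro ⟨h1, h2, h3⟩
            refine ⟨h1, ?_, h2, h3⟩
            rintro x (rfl | hx)
            · exact h
            · exact (h2 x hx).trans h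
          · tauto
      · rcases r with _ | r
        · simp
        · simp only [List.take_succ_cons, List.pairwise_cons, List.mem_cons]
          constructor
          · omega
          · rintro ⟨-, h1, -⟩
            exact absurd (h1 b (Or.inl rfl)) h

theorem decPrefix_cons_of_lt {m : ℕ} {w : List ℕ} (hw : ∀ x ∈ w, x < m) :
    decPrefix (m :: w) = decPrefix w + 1 := by
  cases w <;> simp_all [decPrefix]

theorem decPrefix_insertOne {m : ℕ} {w : List ℕ} (hw : ∀ x ∈ w, x < m) {r : ℕ}
    (hr : r + 1 ≤ decPrefix w) : decPrefix (insertOne m w (r + 1)) = r + 1 := by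
  induction w generalizing r with
  | nil => simp [decPrefix] at hr
  | cons a t ih =>
    rcases r with _ | r
    · have := hw a (by simp)
      simp [insertOne, decPrefix, this.le]
    · cases t with
      | nil => simp [decPrefix] at hr
      | cons b t =>
        rw [decPrefix] at hr
        split_ifs at hr with h
        · have := ih (fun x hx => hw x (by simp [hx])) (r := r) (by omega)
          simp only [insertOne, List.take_succ_cons, List.drop_succ_cons, List.cons_append] at this ⊢
          rw [decPrefix, if_pos h, this]
        · omega

theorem decPrefix_insertTwo_zero (m : ℕ) (w : List ℕ) : decPrefix (insertTwo m w 0) = 1 := by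
  simp [insertTwo, insertOne, decPrefix]

theorem decPrefix_insertTwo_succ {m : ℕ} {w : List ℕ} (hw : ∀ x ∈ w, x < m) {r : ℕ}
    (hr : r + 1 ≤ decPrefix w) : decPrefix (insertTwo m w (r + 1)) = r + 2 := by
  have := decPrefix_insertOne hw hr
  cases w with
  | nil => simp [decPrefix] at hr
  | cons a t =>
    have ha := hw a (by simp)
    simp only [insertTwo, insertOne, List.take_succ_cons, List.drop_succ_cons,
      List.cons_append] at this ⊢
    rw [decPrefix, if_pos ha, this]

theorem length_insertOne (m : ℕ) (w : List ℕ) (r : ℕ) :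
    (insertOne m w r).length = w.length + 1 := by
  simp [insertOne]; omega

theorem length_insertTwo (m : ℕ) (w : List ℕ) (r : ℕ) :
    (insertTwo m w r).length = w.length + 2 := by
  simp [insertTwo, length_insertOne]

theorem insertOne_injOn {m : ℕ} {w : List ℕ} (hw : m ∉ w) :
    Set.InjOn (insertOne m w) (Finset.range (decPrefix w + 1)) := by
  have key : ∀ r ≤ decPrefix w, (insertOne m w r).idxOf m = r := by
    intro r hr
    have := ((le_decPrefix_iff w r).1 hr).1
    rw [insertOne, List.idxOf_append_of_notMem fun h => hw (List.mem_of_mem_take h)]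
    simpa using this
  intro r hr s hs h
  simp only [Finset.coe_range, Set.mem_Iio, Nat.lt_succ_iff] at hr hs
  rw [← key r hr, ← key s hs, h]

theorem filter_of_mem_children {m : ℕ} {w v : List ℕ} (hw : m ∉ w) (hv : v ∈ children m w) :
    v.filter (· ≠ m) = w := by
  have key : ∀ r, (insertOne m w r).filter (· ≠ m) = w := by
    intro r
    have : ∀ l : List ℕ, m ∉ l → l.filter (· ≠ m) = l := fun l hl =>
      List.filter_eq_self.2 fun a ha => by simpa using fun h : a = m => hl (h ▸ ha)
    rw [insertOne, List.filter_append, List.filter_cons_of_neg (by simp), ← List.filter_append,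
      List.take_append_drop, this w hw]
  simp only [children, Finset.mem_union, Finset.mem_image] at hv
  obtain ⟨r, -, rfl⟩ | ⟨r, -, rfl⟩ := hv
  · exact key r
  · rw [insertTwo, List.filter_cons_of_neg (by simp), key]

theorem sum_children {M : Type*} [AddCommMonoid M] {m : ℕ} {w : List ℕ} (hw : ∀ x ∈ w, x < m)
    (f : ℕ → ℕ → M) :
    ∑ v ∈ children m w, f v.length (decPrefix v) =
      ∑ r ∈ Finset.range (decPrefix w + 1), f (w.length + 1) (r + 1) +
        ∑ r ∈ Finset.range (decPrefix w + 1), f (w.length + 2) (r + 1) := by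
  have hm : m ∉ w := fun h => (hw m h).false
  have hinj := insertOne_injOn hm
  rw [children, Finset.sum_union, Finset.sum_image hinj, Finset.sum_image]
  · congr 1
    · rw [Finset.sum_range_succ', Finset.sum_range_succ]
      congr 1
      · refine Finset.sum_congr rfl fun r hr => ?_
        rw [length_insertOne, decPrefix_insertOne hw (by simpa using hr)]
      · rw [length_insertOne, ← decPrefix_cons_of_lt hw]
        simp [insertOne]
    · rw [Finset.sum_range_succ', Finset.sum_range_succ' (fun r => f (w.length + 2) (r + 1))]
      congr 1
      · refine Finset.sum_congr rfl fun r hr => ?_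
        rw [length_insertTwo, decPrefix_insertTwo_succ hw (by simpa using hr)]
      · rw [length_insertTwo, decPrefix_insertTwo_zero]
  · exact fun r hr s hs h => hinj hr hs (List.cons_injective h)
  · rw [Finset.disjoint_left]
    simp only [Finset.mem_image, not_exists, not_and]
    rintro _ ⟨r, -, rfl⟩ s - h
    have := congrArg List.length h
    rw [length_insertOne, length_insertTwo] at this
    omega

theorem weakChainFree_append_cons {m : ℕ} {a b : List ℕ} (ha : ∀ x ∈ a, x < m)
    (hb : ∀ x ∈ b, x < m) :
    WeakChainFree (a ++ m :: b) ↔ WeakChainFree (a ++ b) ∧ a.Pairwise (· > ·) := by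
  have h1 : b.Pairwise (fun y z => m ≤ y → z < y) :=
    List.pairwise_of_forall_mem_list fun y hy z _ h => absurd (hb y hy) h.not_gt
  have h2 : a.Pairwise (fun x y => x ≤ y → m < y) ↔ a.Pairwise (· > ·) :=
    List.Pairwise.iff_of_mem fun {x y} hx hy => by have := ha y hy; grind
  simp only [WeakChainFree, List.triplewise_append, List.triplewise_cons, List.pairwise_cons,
    List.mem_cons, forall_eq_or_imp, h1, h2, true_and]
  constructor
  · rintro ⟨h3, h4, h5, h6, h7⟩
    exact ⟨⟨h3, h4, fun x hx => (h5 x hx).2, h7⟩, h6⟩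
  · rintro ⟨⟨h3, h4, h5, h7⟩, h6⟩
    exact ⟨h3, h4, fun x hx => ⟨fun z hz _ => hb z hz, h5 x hx⟩, h6, h7⟩

theorem weakChainFree_cons_append_cons {m : ℕ} {a b : List ℕ} (ha : ∀ x ∈ a, x < m)
    (hb : ∀ x ∈ b, x < m) :
    WeakChainFree (m :: (a ++ m :: b)) ↔ WeakChainFree (a ++ m :: b) := by
  rw [WeakChainFree, List.triplewise_cons, WeakChainFree, and_iff_right_iff_imp]
  intro _
  simp only [List.pairwise_append, List.pairwise_cons, List.mem_cons, forall_eq_or_imp]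
  have (c : List ℕ) (hc : ∀ x ∈ c, x < m) : c.Pairwise (fun y z => m ≤ y → z < y) :=
    List.pairwise_of_forall_mem_list fun y hy z _ h => absurd (hc y hy) h.not_gt
  exact ⟨this a ha, ⟨fun z hz _ => hb z hz, this b hb⟩, fun x hx =>
    ⟨fun h => absurd (ha x hx) h.not_gt, fun _ _ h => absurd (ha x hx) h.not_gt⟩⟩

theorem mem_children_iff {m : ℕ} {w v : List ℕ} :
    v ∈ children m w ↔ ∃ a b, a ++ b = w ∧ a.Pairwise (· > ·) ∧
      (v = a ++ m :: b ∨ v = m :: (a ++ m :: b)) := by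
  simp only [children, Finset.mem_union, Finset.mem_image, Finset.mem_range, Nat.lt_succ_iff,
    le_decPrefix_iff, insertTwo, insertOne]
  constructor
  · rintro (⟨r, ⟨-, hr⟩, rfl⟩ | ⟨r, ⟨-, hr⟩, rfl⟩)
    · exact ⟨_, _, List.take_append_drop r w, hr, Or.inl rfl⟩
    · exact ⟨_, _, List.take_append_drop r w, hr, Or.inr rfl⟩
  · rintro ⟨a, b, rfl, ha, rfl | rfl⟩
    · exact Or.inl ⟨a.length, by simpa using ha, by simp⟩
    · exact Or.inr ⟨a.length, by simpa using ha, by simp⟩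

theorem mem_chainFreeWords {m : ℕ} {w : List ℕ} :
    w ∈ chainFreeWords m ↔ WeakChainFree w ∧ ∀ x, x ∈ w ↔ x < m := by
  induction m generalizing w with
  | zero =>
    simp only [chainFreeWords, Finset.mem_singleton, not_lt_zero, iff_false,
      ← List.eq_nil_iff_forall_not_mem]
    exact ⟨fun h => ⟨h ▸ .nil, h⟩, And.right⟩
  | succ m ih =>
    simp only [chainFreeWords, Finset.mem_biUnion, mem_children_iff, ih]
    constructor
    · rintro ⟨_, ⟨hc, hmem⟩, a, b, rfl, ha, h⟩
      have ha' : ∀ x ∈ a, x < m := fun x hx => (hmem x).1 (List.mem_append_left _ hx)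
      have hb' : ∀ x ∈ b, x < m := fun x hx => (hmem x).1 (List.mem_append_right _ hx)
      have hfree := (weakChainFree_append_cons ha' hb').2 ⟨hc, ha⟩
      have hlt (x : ℕ) : x ∈ a ∨ x ∈ b ↔ x < m := by rw [← hmem, List.mem_append]
      rcases h with rfl | rfl
      · refine ⟨hfree, fun x => ?_⟩
        have := hlt x
        simp only [List.mem_append, List.mem_cons]
        grind
      · refine ⟨(weakChainFree_cons_append_cons ha' hb').2 hfree, fun x => ?_⟩
        have := hlt x
        simp only [List.mem_append, List.mem_cons]
        grind
    · rintro ⟨hc, hmem⟩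
      obtain ⟨a, b, rfl, hma⟩ := List.eq_append_cons_of_mem ((hmem m).2 m.lt_succ_self)
      have ha : ∀ x ∈ a, x < m := fun x hx => by
        have := (hmem x).1 (by simp [hx])
        have : x ≠ m := fun h => hma (h ▸ hx)
        omega
      by_cases hmb : m ∈ b
      · obtain ⟨c, d, rfl, hmc⟩ := List.eq_append_cons_of_mem hmb
        have hle : ∀ x ∈ a ++ m :: (c ++ m :: d), x ≤ m := fun x hx =>
          Nat.lt_succ_iff.1 ((hmem x).1 hx)
        have hc' : ∀ x ∈ c, x < m := fun x hx =>
          lt_of_le_of_ne (hle x (by simp [hx])) fun h => hmc (h ▸ hx)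
        have hc₀ := hc
        simp only [WeakChainFree, List.triplewise_append, List.triplewise_cons,
          List.pairwise_append, List.pairwise_cons, List.mem_append, List.mem_cons] at hc
        have hd' : ∀ x ∈ d, x < m := by grind
        have hnil : a = [] := by
          refine List.eq_nil_iff_forall_not_mem.2 fun x hx => ?_
          have := ha x hx
          grind
        subst hnil
        rw [List.nil_append] at hc₀ hmem ⊢
        rw [weakChainFree_cons_append_cons hc' hd', weakChainFree_append_cons hc' hd'] at hc₀
        refine ⟨c ++ d, ⟨hc₀.1, fun x => ?_⟩, c, d, rfl, hc₀.2, Or.inr rfl⟩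
        have := hmem x
        simp only [List.mem_append, List.mem_cons] at this ⊢
        grind
      · have hb : ∀ x ∈ b, x < m := fun x hx => by
          have := (hmem x).1 (by simp [hx])
          have : x ≠ m := fun h => hmb (h ▸ hx)
          omega
        rw [weakChainFree_append_cons ha hb] at hc
        refine ⟨a ++ b, ⟨hc.1, fun x => ?_⟩, a, b, rfl, hc.2, Or.inl rfl⟩
        have := hmem x
        simp only [List.mem_append, List.mem_cons] at this ⊢
        grind

theorem sum_chainFreeWords (m d : ℕ) :
    ∑ w ∈ chainFreeWords m, catalanTree d (decPrefix w) • (X : ℕ[X]) ^ w.length =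
      catalanTree (d + m) 0 • (X + X ^ 2) ^ m := by
  induction m generalizing d with
  | zero => simp [chainFreeWords, decPrefix]
  | succ m ih =>
    have hlt : ∀ w ∈ chainFreeWords m, ∀ x ∈ w, x < m := fun w hw x hx =>
      ((mem_chainFreeWords.1 hw).2 x).1 hx
    rw [chainFreeWords, Finset.sum_biUnion]
    · rw [pow_succ, ← smul_mul_assoc, show d + (m + 1) = d + 1 + m by ring, ← ih, Finset.sum_mul]
      refine Finset.sum_congr rfl fun w hw => ?_
      rw [sum_children (hlt w hw) fun l k => catalanTree d k • (X : ℕ[X]) ^ l,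
        ← Finset.sum_smul, ← Finset.sum_smul, catalanTree, smul_mul_assoc, ← smul_add]
      ring
    · intro v hv w hw hne
      rw [Function.onFun, Finset.disjoint_left]
      intro u hu hu'
      apply hne
      rw [← filter_of_mem_children (fun h => (hlt v hv m h).false) hu,
        ← filter_of_mem_children (fun h => (hlt w hw m h).false) hu']

theorem card_chainFreeWords_filter_length (m n : ℕ) (h : m ≤ n) :
    ((chainFreeWords m).filter (·.length = n)).card = m.choose (n - m) * catalanTree m 0 := by
  have := congrArg (coeff · n) (sum_chainFreeWords m 0)
  simp only [catalanTree.eq_1, one_smul, zero_add, finsetSum_coeff, coeff_X_pow, coeff_smul,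
    smul_eq_mul] at this
  rw [Finset.card_filter, mul_comm, ← show ((X + X ^ 2 : ℕ[X]) ^ m).coeff n = m.choose (n - m) by
    rw [show (X + X ^ 2 : ℕ[X]) = X * (1 + X) by ring, mul_pow, coeff_X_pow_mul', if_pos h,
      coeff_one_add_X_pow, Nat.cast_id], ← this]
  simp only [eq_comm]

theorem catalanTree_add_choose (d k : ℕ) :
    catalanTree (d + 1) k + (2 * d + 2 + k).choose d = (2 * d + 2 + k).choose (d + 1) := by
  induction d generalizing k with
  | zero => simp [catalanTree]; omega
  | succ d ihd =>
    induction k with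
    | zero =>
      have h1 := ihd 1
      have e : catalanTree (d + 1 + 1) 0 = catalanTree (d + 1) 1 := by simp [catalanTree]
      have h2 := Nat.choose_succ_succ (2 * d + 3) d
      have h3 := Nat.choose_succ_succ (2 * d + 3) (d + 1)
      have h4 : (2 * d + 3).choose (d + 2) = (2 * d + 3).choose (d + 1) :=
        Nat.choose_symm_of_eq_add (by omega)
      simp only [Nat.succ_eq_add_one, add_zero, show 2 * (d + 1) + 2 = 2 * d + 3 + 1 by ring,
        show 2 * d + 2 + 1 = 2 * d + 3 by ring, show d + 1 + 1 = d + 2 by ring] at *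
      omega
    | succ k ihk =>
      have h1 := ihd (k + 2)
      have e : catalanTree (d + 1 + 1) (k + 1) =
          catalanTree (d + 1 + 1) k + catalanTree (d + 1) (k + 2) := by
        rw [catalanTree.eq_2 (k + 1) (d + 1), Finset.sum_range_succ, ← catalanTree.eq_2 k (d + 1)]
      have h2 := Nat.choose_succ_succ (2 * d + 4 + k) d
      have h3 := Nat.choose_succ_succ (2 * d + 4 + k) (d + 1)
      simp only [Nat.succ_eq_add_one, show 2 * (d + 1) + 2 + (k + 1) = 2 * d + 4 + k + 1 by ring,
        show 2 * (d + 1) + 2 + k = 2 * d + 4 + k by ring,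
        show 2 * d + 2 + (k + 2) = 2 * d + 4 + k by ring, show d + 1 + 1 = d + 2 by ring] at *
      omega

theorem catalanTree_zero_right (d : ℕ) : catalanTree d 0 = catalan d := by
  rcases d with _ | d
  · simp [catalanTree]
  have h1 := catalanTree_add_choose d 0
  have h2 := succ_mul_catalan_eq_centralBinom (d + 1)
  rw [Nat.centralBinom] at h2
  have h3 := Nat.choose_succ_right_eq (2 * d + 2) d
  rw [show 2 * (d + 1) = 2 * d + 2 by ring] at h2
  rw [show 2 * d + 2 - d = d + 2 by omega] at h3
  rw [add_zero] at h1
  have : (d + 2) * catalanTree (d + 1) 0 = (d + 2) * catalan (d + 1) := by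
    nlinarith
  exact Nat.eq_of_mul_eq_mul_left (by omega) this

theorem not_chainLeLe_iff {n : ℕ} (p : Fin n → Fin n) :
    ¬ ChainLeLe p ↔ WeakChainFree (List.ofFn fun i => (p i : ℕ)) := by
  simp only [WeakChainFree, List.triplewise_iff_getElem, List.length_ofFn, List.getElem_ofFn,
    ChainLeLe, not_exists, not_and, not_le, Fin.lt_def, Fin.le_def]
  exact ⟨fun h i j k hij hjk hk => h ⟨i, by omega⟩ ⟨j, by omega⟩ ⟨k, hk⟩ hij hjk,
    fun h i j k hij hjk => h i j k hij hjk k.2⟩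

theorem isOSP_iff {n : ℕ} (p : Fin n → Fin n) :
    IsOSP p ↔ ∃ m ≤ n, ∀ x, x ∈ List.ofFn (fun i => (p i : ℕ)) ↔ x < m := by
  simp only [List.mem_ofFn]
  constructor
  · intro hp
    have hex : ∃ v, ¬ ∃ i, (p i : ℕ) = v := ⟨n, fun ⟨i, hi⟩ => (hi ▸ (p i).2).false⟩
    obtain ⟨m, hm, hmin⟩ : ∃ m, (¬ ∃ i, (p i : ℕ) = m) ∧ ∀ v < m, ∃ i, (p i : ℕ) = v := by
      classical
      exact ⟨Nat.find hex, Nat.find_spec hex, fun v h => not_not.1 (Nat.find_min hex h)⟩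
    refine ⟨m, not_lt.1 fun h => ?_, fun x => ⟨?_, hmin x⟩⟩
    · obtain ⟨i, hi⟩ := hmin n h
      exact (hi ▸ (p i).2).false
    · rintro ⟨i, rfl⟩
      by_contra! h
      obtain ⟨j, hj⟩ := hp i ⟨m, h.trans_lt (p i).2⟩ h
      exact hm ⟨j, by rw [hj]⟩
  · rintro ⟨m, -, hm⟩ i v hv
    obtain ⟨j, hj⟩ := (hm v).2 (lt_of_le_of_lt hv ((hm _).1 ⟨i, rfl⟩))
    exact ⟨j, Fin.ext hj⟩

theorem card_isOSP_not_chainLeLe (n : ℕ) :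
    Nat.card {p : Fin n → Fin n // IsOSP p ∧ ¬ ChainLeLe p} =
      ∑ m ∈ Finset.range (n + 1), ((chainFreeWords m).filter (·.length = n)).card := by
  rw [← Finset.card_biUnion]
  · rw [← Nat.card_eq_finsetCard]
    have hmem (p : Fin n → Fin n) : List.ofFn (fun i => (p i : ℕ)) ∈
        (Finset.range (n + 1)).biUnion (fun m => (chainFreeWords m).filter (·.length = n)) ↔
        IsOSP p ∧ ¬ ChainLeLe p := by
      simp only [Finset.mem_biUnion, Finset.mem_filter, mem_chainFreeWords, List.length_ofFn,
        not_chainLeLe_iff, isOSP_iff, Finset.mem_range, Nat.lt_succ_iff]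
      exact ⟨fun ⟨m, h, ⟨hc, hm⟩, _⟩ => ⟨⟨m, h, hm⟩, hc⟩,
        fun ⟨⟨m, h, hm⟩, hc⟩ => ⟨m, h, ⟨hc, hm⟩, trivial⟩⟩
    refine Nat.card_eq_of_bijective
      (fun p => ⟨List.ofFn fun i => (p.1 i : ℕ), (hmem p.1).2 p.2⟩) ⟨fun p q h => ?_, ?_⟩
    · have := List.ofFn_injective (congrArg Subtype.val h)
      exact Subtype.ext (funext fun i => Fin.ext (congrFun this i))
    · rintro ⟨w, hw⟩
      have hw' := hw
      simp only [Finset.mem_biUnion, Finset.mem_filter, mem_chainFreeWords, Finset.mem_range,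
        Nat.lt_succ_iff] at hw'
      obtain ⟨m, hmn, ⟨-, hm⟩, rfl⟩ := hw'
      have hofFn : List.ofFn (fun i : Fin w.length => w[i]) = w := List.ofFn_getElem
      refine ⟨⟨fun i => ⟨w[i], ((hm _).1 (List.getElem_mem i.2)).trans_le hmn⟩,
        (hmem _).1 ?_⟩, Subtype.ext hofFn⟩
      simpa only [hofFn] using hw
  · intro a _ b _ hab
    rw [Function.onFun, Finset.disjoint_left]
    intro w hw hw'
    have h1 := (mem_chainFreeWords.1 (Finset.mem_filter.1 hw).1).2
    have h2 := (mem_chainFreeWords.1 (Finset.mem_filter.1 hw').1).2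
    exact hab (eq_of_forall_lt_iff fun x => by rw [← h1, h2])

/-- The number of ordered set partitions of `[n]` avoiding the condition
`x_{i1} ≤ x_{i2} ≤ x_{i3}` equals `Σ_{j=0}^{⌊n/2⌋} binom(n-j, j) · C_{n-j}`. -/
theorem woc_active_lele_catalan (n : ℕ) (hn : 1 ≤ n) :
    Nat.card {p : Fin n → Fin n // IsOSP p ∧ ¬ ChainLeLe p}
      = ∑ j ∈ Finset.range (n / 2 + 1), (n - j).choose j * catalan (n - j) := by
  rw [card_isOSP_not_chainLeLe, ← Finset.sum_range_reflect]
  symm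
  refine Finset.sum_subset_zero_on_sdiff (Finset.range_mono (by omega)) ?_ ?_
  · intro j hj
    simp only [Finset.mem_sdiff, Finset.mem_range] at hj
    rw [card_chainFreeWords_filter_length _ _ (by omega), Nat.choose_eq_zero_of_lt (by omega),
      zero_mul]
  · intro j hj
    rw [Finset.mem_range] at hj
    rw [card_chainFreeWords_filter_length _ _ (by omega), catalanTree_zero_right,
      show n + 1 - 1 - j = n - j by omega, show n - (n - j) = j by omega]
end

section
/- For every n ≥ 3 and 0 ≤ d ≤ n − 1, the number of permutations σ of [n] that contain the pattern 321, have exactly d descents, and whose reduction σ′ ∈ S_{n−1} (obtained by deleting the entry n from σ) avoids 321, equals g_{n, n−1−d}. -/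
/-- `σ` contains the pattern 321. -/
def Contains321 {n : ℕ} (σ : Equiv.Perm (Fin n)) : Prop :=
  ∃ i j k : Fin n, i < j ∧ j < k ∧ σ j < σ i ∧ σ k < σ j

/-- The reduction of `σ` (obtained by deleting the largest entry from the
one-line notation of `σ`) avoids the pattern 321; equivalently, `σ` has no
occurrence of 321 using only entries different from the maximum value
(in an occurrence `σ i > σ j > σ k` only `σ i` can be the maximum). -/
def ReductionAvoids321 {n : ℕ} (σ : Equiv.Perm (Fin n)) : Prop :=
  ¬ ∃ i j k : Fin n, i < j ∧ j < k ∧ σ j < σ i ∧ σ k < σ j ∧ ∃ l, σ i < σ l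

/-- Reversal of the one-line notation of a permutation of `Fin n`. -/
def reversePerm (n : ℕ) : Equiv.Perm (Fin n) ≃ Equiv.Perm (Fin n) where
  toFun σ := Fin.revPerm.trans σ
  invFun σ := Fin.revPerm.trans σ
  left_inv σ := by ext; simp
  right_inv σ := by ext; simp

lemma reversePerm_apply {n : ℕ} (σ : Equiv.Perm (Fin n)) (i : Fin n) :
    reversePerm n σ i = σ i.rev := rfl

lemma contains123_reversePerm {n : ℕ} (σ : Equiv.Perm (Fin n)) :
    Contains123 (reversePerm n σ) ↔ Contains321 σ := by
  simp only [Contains123, Contains321, reversePerm_apply]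
  constructor <;> rintro ⟨i, j, k, hij, hjk, h₁, h₂⟩ <;>
    exact ⟨k.rev, j.rev, i.rev, Fin.rev_lt_rev.2 hjk, Fin.rev_lt_rev.2 hij,
      by simpa using h₂, by simpa using h₁⟩

lemma reductionAvoids123_reversePerm {n : ℕ} (σ : Equiv.Perm (Fin n)) :
    ReductionAvoids123 (reversePerm n σ) ↔ ReductionAvoids321 σ := by
  simp only [ReductionAvoids123, ReductionAvoids321, reversePerm_apply]
  refine not_congr ?_
  constructor <;> rintro ⟨i, j, k, hij, hjk, h₁, h₂, l, hl⟩ <;>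
    exact ⟨k.rev, j.rev, i.rev, Fin.rev_lt_rev.2 hjk, Fin.rev_lt_rev.2 hij,
      by simpa using h₂, by simpa using h₁, l.rev, by simpa using hl⟩

/-- The descents of the reversal of `σ` correspond to the ascents of `σ`. -/
lemma descents_reversePerm_eq_card_ascents {n : ℕ} (σ : Equiv.Perm (Fin n)) :
    descents (reversePerm n σ) =
      Nat.card {q : Fin n × Fin n // q.1.val + 1 = q.2.val ∧ σ q.1 < σ q.2} := by
  refine Nat.card_congr (Equiv.subtypeEquiv
    ((Equiv.prodComm _ _).trans (Equiv.prodCongr Fin.revPerm Fin.revPerm)) ?_)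
  rintro ⟨a, b⟩
  simp only [reversePerm_apply, Equiv.trans_apply, Equiv.prodComm_apply, Prod.swap_prod_mk,
    Equiv.prodCongr_apply, Prod.map_apply, Fin.revPerm_apply, Fin.val_rev]
  refine and_congr_left fun _ => ?_
  omega

lemma card_adjacent_pairs (n : ℕ) :
    Nat.card {q : Fin n × Fin n // q.1.val + 1 = q.2.val} = n - 1 := by
  let e : {q : Fin n × Fin n // q.1.val + 1 = q.2.val} ≃ Fin (n - 1) :=
    { toFun := fun q => ⟨q.1.1, by have := q.2; have := q.1.2.isLt; omega⟩
      invFun := fun i => ⟨(⟨i, by omega⟩, ⟨i + 1, by omega⟩), rfl⟩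
      left_inv := by
        rintro ⟨⟨a, b⟩, h⟩
        exact Subtype.ext (Prod.ext rfl (Fin.ext h))
      right_inv := fun _ => rfl }
  simpa using Nat.card_congr e

lemma descents_add_descents_reversePerm {n : ℕ} (σ : Equiv.Perm (Fin n)) :
    descents σ + descents (reversePerm n σ) = n - 1 := by
  classical
  rw [descents_reversePerm_eq_card_ascents, descents, ← card_adjacent_pairs n]
  simp only [Nat.card_eq_fintype_card, Fintype.card_subtype]
  rw [← Finset.card_union_of_disjoint]
  · congr 1
    ext ⟨a, b⟩
    simp only [Finset.mem_union, Finset.mem_filter, Finset.mem_univ, true_and, ← and_or_left,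
      and_iff_left_iff_imp]
    intro h
    refine lt_or_gt_of_ne fun he => ?_
    have := congrArg Fin.val (σ.injective he)
    omega
  · refine Finset.disjoint_filter.2 fun q _ h₁ h₂ => ?_
    exact lt_asymm h₁.2 h₂.2

/-- For `n ≥ 3` and `0 ≤ d ≤ n-1`, the number of permutations of `[n]` that contain
the pattern 321, have exactly `d` descents, and whose reduction avoids 321,
equals `g_{n, n-1-d}`. -/
theorem card_contains321_eq_g123 (n d : ℕ) (hn : 3 ≤ n) (hd : d ≤ n - 1) :
    Nat.card {σ : Equiv.Perm (Fin n) //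
        Contains321 σ ∧ descents σ = d ∧ ReductionAvoids321 σ}
      = g123 n (n - 1 - d) := by
  refine Nat.card_congr (Equiv.subtypeEquiv (reversePerm n) fun σ => ?_)
  rw [contains123_reversePerm, reductionAvoids123_reversePerm]
  have := descents_add_descents_reversePerm σ
  refine and_congr_right fun _ => and_congr_left fun _ => ?_
  omega
end

section
/- For every n ≥ 1, the number of ordered set partitions of [n] that avoid the condition x_{i1} ≤ x_{i2} < x_{i3} (i.e., there are no indices i1 < i2 < i3 with pos(i1) ≤ pos(i2) < pos(i3)) equals Σ_{v=0}^{n−1} 2^v · N_{n,v}, where N_{n,v} = (1/n)·binom(n,v)·binom(n,v+1) is the Narayana number; this count is the n-th little Schröder number. -/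
/-- The ordered set partition encoded by `p` contains the condition
`x_{i1} ≤ x_{i2} < x_{i3}` with `i1 < i2 < i3`. -/
def ChainLeLt {n : ℕ} (p : Fin n → Fin n) : Prop :=
  ∃ i j k : Fin n, i < j ∧ j < k ∧ p i ≤ p j ∧ p j < p k

/-- `IsOSP` for words with values in `ℕ`, together with the avoidance of `ChainLeLt`. -/
def IsGoodWord {n : ℕ} (w : Fin n → ℕ) : Prop :=
  (∀ i v, v ≤ w i → ∃ j, w j = v) ∧
    ∀ i j k, i < j → j < k → w i ≤ w j → w j < w k → False

/-- The number of blocks of a good word: one more than its largest letter. -/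
def letterBound {n : ℕ} (w : Fin n → ℕ) : ℕ :=
  Finset.univ.sup fun i => w i + 1

/-- The least letter that can be put in front of a good word: one more than the largest letter
which is the lower end of an ascent. -/
def ascentBound {n : ℕ} (w : Fin n → ℕ) : ℕ :=
  Finset.univ.sup fun i => Finset.univ.sup fun j => if i < j ∧ w i < w j then w i + 1 else 0

theorem letterBound_le {n : ℕ} {w : Fin n → ℕ} {b : ℕ} :
    letterBound w ≤ b ↔ ∀ i, w i < b := by
  simp [letterBound, Finset.sup_le_iff]

theorem lt_letterBound {n : ℕ} {w : Fin n → ℕ} {b : ℕ} :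
    b < letterBound w ↔ ∃ i, b ≤ w i := by
  rw [← not_le, letterBound_le]
  push Not
  rfl

theorem ascentBound_le {n : ℕ} {w : Fin n → ℕ} {b : ℕ} :
    ascentBound w ≤ b ↔ ∀ i j, i < j → w i < w j → w i < b := by
  simp only [ascentBound, Finset.sup_le_iff, Finset.mem_univ, true_implies]
  refine forall_congr' fun i => forall_congr' fun j => ?_
  split_ifs with h
  · simp [h]
  · constructor
    · intro _ h1 h2
      exact absurd ⟨h1, h2⟩ h
    · intro _
      exact Nat.zero_le _

theorem ascentBound_le_letterBound {n : ℕ} (w : Fin n → ℕ) :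
    ascentBound w ≤ letterBound w :=
  ascentBound_le.2 fun i _ _ _ => letterBound_le.1 le_rfl i

/-- Increase by one all letters `≥ v`. -/
def shiftLetter (v x : ℕ) : ℕ := if x < v then x else x + 1

/-- Decrease by one all letters `> v`. -/
def unshiftLetter (v x : ℕ) : ℕ := if x ≤ v then x else x - 1

theorem shiftLetter_ne (v x : ℕ) : shiftLetter v x ≠ v := by
  unfold shiftLetter; split_ifs <;> omega

theorem unshiftLetter_shiftLetter (v x : ℕ) : unshiftLetter v (shiftLetter v x) = x := by
  unfold shiftLetter unshiftLetter; split_ifs <;> omega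

theorem shiftLetter_unshiftLetter {v x : ℕ} (h : x ≠ v) :
    shiftLetter v (unshiftLetter v x) = x := by
  unfold shiftLetter unshiftLetter; split_ifs <;> omega

theorem shiftLetter_strictMono (v : ℕ) : StrictMono (shiftLetter v) := by
  intro x y h
  unfold shiftLetter; split_ifs <;> omega

theorem IsGoodWord.mem_range_iff {n : ℕ} {w : Fin n → ℕ} (hw : IsGoodWord w) (v : ℕ) :
    (∃ i, w i = v) ↔ v < letterBound w := by
  rw [lt_letterBound]
  exact ⟨fun ⟨i, hi⟩ => ⟨i, hi.ge⟩, fun ⟨i, hi⟩ => hw.1 i v hi⟩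

theorem avoids_cons_iff {n : ℕ} {w : Fin n → ℕ} {v : ℕ} :
    (∀ i j k : Fin (n + 1), i < j → j < k → (Fin.cons v w : Fin (n + 1) → ℕ) i ≤
        (Fin.cons v w : Fin (n + 1) → ℕ) j →
        (Fin.cons v w : Fin (n + 1) → ℕ) j < (Fin.cons v w : Fin (n + 1) → ℕ) k → False) ↔
      (∀ i j k, i < j → j < k → w i ≤ w j → w j < w k → False) ∧ ascentBound w ≤ v := by
  rw [ascentBound_le]
  constructor
  · intro h
    refine ⟨fun i j k hij hjk h1 h2 => h i.succ j.succ k.succ (by simpa) (by simpa)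
      (by simpa) (by simpa), fun i j hij h1 => ?_⟩
    by_contra! h2
    exact h 0 i.succ j.succ (Fin.succ_pos _) (by simpa) (by simpa) (by simpa)
  · rintro ⟨h1, h2⟩ i j k hij hjk
    obtain ⟨j, rfl⟩ := Fin.exists_succ_eq.2 (Fin.ne_zero_of_lt hij)
    obtain ⟨k, rfl⟩ := Fin.exists_succ_eq.2 (Fin.ne_zero_of_lt hjk)
    rw [Fin.succ_lt_succ_iff] at hjk
    induction i using Fin.cases with
    | zero =>
      simp only [Fin.cons_zero, Fin.cons_succ]
      intro h3 h4
      exact absurd (h2 j k hjk h4) (not_lt.2 h3)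
    | succ i =>
      rw [Fin.succ_lt_succ_iff] at hij
      simpa only [Fin.cons_succ] using h1 i j k hij hjk

theorem isGoodWord_cons_of_mem_range {n : ℕ} {w : Fin n → ℕ} {v : ℕ} (hv : ∃ i, w i = v) :
    IsGoodWord (Fin.cons v w : Fin (n + 1) → ℕ) ↔ IsGoodWord w ∧ ascentBound w ≤ v := by
  unfold IsGoodWord
  rw [avoids_cons_iff, and_assoc]
  refine and_congr_left fun _ => ?_
  obtain ⟨i₀, rfl⟩ := hv
  simp only [Fin.forall_fin_succ, Fin.exists_fin_succ, Fin.cons_zero, Fin.cons_succ]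
  constructor
  · rintro ⟨_, h⟩ i v hv
    rcases h i v hv with h | h
    · exact ⟨i₀, h⟩
    · exact h
  · intro h
    exact ⟨fun v hv => Or.inr (h i₀ v hv), fun i v hv => Or.inr (h i v hv)⟩

theorem ascentBound_shift_le {n : ℕ} {w : Fin n → ℕ} {v b : ℕ} (hb : b ≤ v) :
    ascentBound (shiftLetter v ∘ w) ≤ b ↔ ascentBound w ≤ b := by
  rw [ascentBound_le, ascentBound_le]
  refine forall₃_congr fun i j _ => ?_
  simp only [Function.comp, (shiftLetter_strictMono v).lt_iff_lt]
  refine imp_congr_right fun _ => ?_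
  unfold shiftLetter; split_ifs <;> omega

theorem ascentBound_shift {n : ℕ} {w : Fin n → ℕ} {v : ℕ} (hv : ascentBound w ≤ v) :
    ascentBound (shiftLetter v ∘ w) = ascentBound w := by
  have h := (ascentBound_shift_le hv).2 le_rfl
  exact le_antisymm h ((ascentBound_shift_le (h.trans hv)).1 le_rfl)

theorem letterBound_shift {n : ℕ} (w : Fin n → ℕ) (v : ℕ) :
    letterBound (shiftLetter v ∘ w) =
      if v < letterBound w then letterBound w + 1 else letterBound w := by
  refine eq_of_forall_lt_iff fun b => ?_
  split_ifs with h
  · obtain ⟨i₀, hi₀⟩ := lt_letterBound.1 h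
    rw [lt_letterBound]
    rcases b with _ | b
    · simp only [Nat.zero_le, Nat.succ_pos, iff_true]
      exact ⟨i₀, trivial⟩
    rw [Nat.succ_lt_succ_iff, lt_letterBound]
    simp only [Function.comp, shiftLetter]
    constructor
    · rintro ⟨i, hi⟩
      refine ⟨i, ?_⟩
      split_ifs at hi <;> omega
    · rintro ⟨i, hi⟩
      by_cases h2 : w i < v
      · refine ⟨i₀, ?_⟩
        split_ifs <;> omega
      · refine ⟨i, ?_⟩
        split_ifs; omega
  · rw [lt_letterBound, lt_letterBound]
    have h1 := fun i => letterBound_le.1 (not_lt.1 h) i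
    simp [shiftLetter, h1]

theorem isGoodWord_cons_shift {n : ℕ} {w : Fin n → ℕ} {v : ℕ} :
    IsGoodWord (Fin.cons v (shiftLetter v ∘ w) : Fin (n + 1) → ℕ) ↔
      IsGoodWord w ∧ ascentBound w ≤ v ∧ v ≤ letterBound w := by
  unfold IsGoodWord
  rw [avoids_cons_iff, ascentBound_shift_le le_rfl]
  have h1 : (∀ i j k, i < j → j < k → (shiftLetter v ∘ w) i ≤ (shiftLetter v ∘ w) j →
      (shiftLetter v ∘ w) j < (shiftLetter v ∘ w) k → False) ↔
      (∀ i j k, i < j → j < k → w i ≤ w j → w j < w k → False) := by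
    simp only [Function.comp, (shiftLetter_strictMono v).lt_iff_lt,
      (shiftLetter_strictMono v).le_iff_le]
  rw [h1]
  suffices h : (∀ (i : Fin (n + 1)) (u : ℕ),
      u ≤ (Fin.cons v (shiftLetter v ∘ w) : Fin (n + 1) → ℕ) i →
      ∃ j, (Fin.cons v (shiftLetter v ∘ w) : Fin (n + 1) → ℕ) j = u) ↔
      (∀ i u, u ≤ w i → ∃ j, w j = u) ∧ v ≤ letterBound w by
    rw [h]; tauto
  simp only [Fin.forall_fin_succ, Fin.exists_fin_succ, Fin.cons_zero, Fin.cons_succ,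
    Function.comp]
  constructor
  · rintro ⟨h2, h3⟩
    constructor
    · intro i u hu
      have h4 := h3 i (shiftLetter v u) ((shiftLetter_strictMono v).monotone hu)
      rcases h4 with h4 | ⟨j, hj⟩
      · exact absurd h4.symm (shiftLetter_ne v u)
      · exact ⟨j, (shiftLetter_strictMono v).injective hj⟩
    · rcases v with _ | v
      · exact Nat.zero_le _
      rcases h2 v (Nat.le_succ v) with h4 | ⟨j, hj⟩
      · omega
      · refine Nat.succ_le_of_lt (lt_letterBound.2 ⟨j, ?_⟩)
        unfold shiftLetter at hj
        split_ifs at hj <;> omega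
  · rintro ⟨h2, h3⟩
    have key : ∀ u, u < letterBound w → ∃ j, shiftLetter v (w j) = shiftLetter v u := by
      intro u hu
      obtain ⟨i, hi⟩ := lt_letterBound.1 hu
      obtain ⟨j, hj⟩ := h2 i u hi
      exact ⟨j, by rw [hj]⟩
    constructor
    · intro u hu
      rcases hu.eq_or_lt with rfl | hu
      · exact Or.inl rfl
      · obtain ⟨j, hj⟩ := key u (by omega)
        refine Or.inr ⟨j, hj.trans ?_⟩
        simp [shiftLetter, hu]
    · intro i u hu
      by_cases huv : u = v
      · exact Or.inl huv.symm
      · rw [← shiftLetter_unshiftLetter huv, (shiftLetter_strictMono v).le_iff_le] at hu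
        obtain ⟨j, hj⟩ := key _ (lt_letterBound.2 ⟨i, hu⟩)
        exact Or.inr ⟨j, hj.trans (shiftLetter_unshiftLetter huv)⟩

theorem letterBound_cons {n : ℕ} (w : Fin n → ℕ) (v : ℕ) :
    letterBound (Fin.cons v w : Fin (n + 1) → ℕ) = max (v + 1) (letterBound w) := by
  refine eq_of_forall_ge_iff fun b => ?_
  simp [letterBound_le, Fin.forall_fin_succ]

theorem ascentBound_cons {n : ℕ} {w : Fin n → ℕ} {v : ℕ} (hv : ascentBound w ≤ v) :
    ascentBound (Fin.cons v w : Fin (n + 1) → ℕ) =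
      if v + 1 < letterBound w then v + 1 else ascentBound w := by
  have h0 : ∀ b, ascentBound (Fin.cons v w : Fin (n + 1) → ℕ) ≤ b ↔
      (v + 1 < letterBound w → v < b) ∧ ascentBound w ≤ b := by
    intro b
    rw [ascentBound_le, lt_letterBound, ascentBound_le]
    simp [Fin.forall_fin_succ]
  refine eq_of_forall_ge_iff fun b => ?_
  rw [h0]
  split_ifs with h
  · simp only [h, true_implies]
    omega
  · simp [h]

theorem IsGoodWord.lt {n : ℕ} {w : Fin n → ℕ} (hw : IsGoodWord w) (i : Fin n) : w i < n := by
  have h : Finset.range (w i + 1) ⊆ Finset.univ.image w := by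
    intro v hv
    obtain ⟨j, hj⟩ := hw.1 i v (Nat.lt_succ_iff.1 (Finset.mem_range.1 hv))
    exact Finset.mem_image.2 ⟨j, Finset.mem_univ _, hj⟩
  have h2 := (Finset.card_le_card h).trans Finset.card_image_le
  simpa [Nat.succ_le_iff] using h2

open Classical in
/-- The finite set of good words of length `n`. -/
noncomputable def goodWords (n : ℕ) : Finset (Fin n → ℕ) :=
  (Fintype.piFinset fun _ => Finset.range n).filter IsGoodWord

theorem mem_goodWords {n : ℕ} {w : Fin n → ℕ} : w ∈ goodWords n ↔ IsGoodWord w := by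
  simp only [goodWords, Finset.mem_filter, Fintype.mem_piFinset, Finset.mem_range,
    and_iff_right_iff_imp]
  exact fun h => h.lt

theorem card_eq_card_goodWords (n : ℕ) :
    Nat.card {p : Fin n → Fin n // IsOSP p ∧ ¬ ChainLeLt p} = (goodWords n).card := by
  rw [← Nat.card_eq_finsetCard]
  refine Nat.card_congr
    { toFun := fun p => ⟨fun i => p.1 i, mem_goodWords.2 ⟨fun i v hv => ?_, ?_⟩⟩
      invFun := fun w => ⟨fun i => ⟨w.1 i, (mem_goodWords.1 w.2).lt i⟩, ?_, ?_⟩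
      left_inv := fun p => rfl
      right_inv := fun w => rfl }
  · obtain ⟨j, hj⟩ := p.2.1 i ⟨v, hv.trans_lt (p.1 i).2⟩ hv
    exact ⟨j, congrArg Fin.val hj⟩
  · intro i j k hij hjk h1 h2
    exact p.2.2 ⟨i, j, k, hij, hjk, h1, h2⟩
  · intro i v hv
    obtain ⟨j, hj⟩ := (mem_goodWords.1 w.2).1 i v hv
    exact ⟨j, Fin.ext hj⟩
  · rintro ⟨i, j, k, hij, hjk, h1, h2⟩
    exact (mem_goodWords.1 w.2).2 i j k hij hjk h1 h2

theorem sum_goodWords_succ (n : ℕ) (g : (Fin (n + 1) → ℕ) → ℕ) :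
    ∑ w ∈ goodWords (n + 1), g w = ∑ w ∈ goodWords n,
      (∑ v ∈ Finset.Ico (ascentBound w) (letterBound w), g (Fin.cons v w) +
        ∑ v ∈ Finset.Ico (ascentBound w) (letterBound w + 1),
          g (Fin.cons v (shiftLetter v ∘ w))) := by
  classical
  rw [← Finset.sum_filter_add_sum_filter_not (goodWords (n + 1))
    (fun w => ∃ i, Fin.tail w i = w 0), Finset.sum_add_distrib, Finset.sum_sigma',
    Finset.sum_sigma']
  congr 1
  · refine Finset.sum_nbij' (fun w => ⟨Fin.tail w, w 0⟩) (fun x => Fin.cons x.2 x.1)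
      ?_ ?_ ?_ ?_ ?_
    · intro w hw
      rw [Finset.mem_filter, mem_goodWords] at hw
      obtain ⟨h1, h2⟩ := hw
      rw [← Fin.cons_self_tail w, isGoodWord_cons_of_mem_range h2] at h1
      rw [Finset.mem_sigma, mem_goodWords, Finset.mem_Ico, ← h1.1.mem_range_iff]
      exact ⟨h1.1, h1.2, h2⟩
    · rintro ⟨w, v⟩ hw
      rw [Finset.mem_sigma, mem_goodWords, Finset.mem_Ico] at hw
      obtain ⟨h1, h2, h3⟩ := hw
      rw [← IsGoodWord.mem_range_iff h1] at h3
      rw [Finset.mem_filter, mem_goodWords, isGoodWord_cons_of_mem_range h3]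
      exact ⟨⟨h1, h2⟩, by simpa using h3⟩
    · intro w _
      exact Fin.cons_self_tail w
    · rintro ⟨w, v⟩ _
      simp
    · intro w _
      simp
  · have key : ∀ w : Fin (n + 1) → ℕ, (¬ ∃ i, Fin.tail w i = w 0) →
        (Fin.cons (w 0) (shiftLetter (w 0) ∘ (unshiftLetter (w 0) ∘ Fin.tail w)) :
          Fin (n + 1) → ℕ) = w := by
      intro w hw
      conv_rhs => rw [← Fin.cons_self_tail w]
      congr 1
      funext i
      exact shiftLetter_unshiftLetter fun h => hw ⟨i, h⟩
    refine Finset.sum_nbij' (fun w => ⟨unshiftLetter (w 0) ∘ Fin.tail w, w 0⟩)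
      (fun x => Fin.cons x.2 (shiftLetter x.2 ∘ x.1)) ?_ ?_ ?_ ?_ ?_
    · intro w hw
      rw [Finset.mem_filter, mem_goodWords] at hw
      obtain ⟨h1, h2⟩ := hw
      rw [← key w h2, isGoodWord_cons_shift] at h1
      rw [Finset.mem_sigma, mem_goodWords, Finset.mem_Ico, Nat.lt_succ_iff]
      exact h1
    · rintro ⟨w, v⟩ hw
      rw [Finset.mem_sigma, mem_goodWords, Finset.mem_Ico, Nat.lt_succ_iff] at hw
      rw [Finset.mem_filter, mem_goodWords, isGoodWord_cons_shift]
      refine ⟨hw, ?_⟩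
      rintro ⟨i, hi⟩
      exact shiftLetter_ne _ _ hi
    · intro w hw
      exact key w (Finset.mem_filter.1 hw).2
    · rintro ⟨w, v⟩ _
      simp only [Fin.cons_zero, Fin.tail_cons, Sigma.mk.injEq, heq_eq_eq, and_true]
      funext i
      exact unshiftLetter_shiftLetter _ _
    · intro w hw
      simp only [key w (Finset.mem_filter.1 hw).2]

/-- The number of ways to extend to the left by `m` letters a good word in which `h` letters can
be repeated at the front. -/
def extensionCount : ℕ → ℕ → ℕ
  | 0, _ => 1
  | m + 1, h =>
    extensionCount m (h + 1) + 2 * ∑ i ∈ Finset.range h, extensionCount m (i + 1)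

theorem sum_extensions (g : ℕ → ℕ) {n : ℕ} (w : Fin n → ℕ) :
    ∑ v ∈ Finset.Ico (ascentBound w) (letterBound w),
        g (letterBound (Fin.cons v w : Fin (n + 1) → ℕ) -
          ascentBound (Fin.cons v w : Fin (n + 1) → ℕ)) +
      ∑ v ∈ Finset.Ico (ascentBound w) (letterBound w + 1),
        g (letterBound (Fin.cons v (shiftLetter v ∘ w) : Fin (n + 1) → ℕ) -
          ascentBound (Fin.cons v (shiftLetter v ∘ w) : Fin (n + 1) → ℕ)) =
      g (letterBound w - ascentBound w + 1) +
        2 * ∑ i ∈ Finset.range (letterBound w - ascentBound w), g (i + 1) := by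
  have hle := ascentBound_le_letterBound w
  have e1 : ∑ v ∈ Finset.Ico (ascentBound w) (letterBound w),
        g (letterBound (Fin.cons v w : Fin (n + 1) → ℕ) -
          ascentBound (Fin.cons v w : Fin (n + 1) → ℕ)) =
      ∑ v ∈ Finset.Ico (ascentBound w) (letterBound w),
        g (if v + 1 < letterBound w then letterBound w - (v + 1)
          else letterBound w - ascentBound w) := by
    refine Finset.sum_congr rfl fun v hv => ?_
    rw [Finset.mem_Ico] at hv
    rw [letterBound_cons, ascentBound_cons hv.1, max_eq_right hv.2]
    split_ifs <;> rfl
  have e2 : ∑ v ∈ Finset.Ico (ascentBound w) (letterBound w + 1),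
        g (letterBound (Fin.cons v (shiftLetter v ∘ w) : Fin (n + 1) → ℕ) -
          ascentBound (Fin.cons v (shiftLetter v ∘ w) : Fin (n + 1) → ℕ)) =
      ∑ v ∈ Finset.Ico (ascentBound w) (letterBound w + 1),
        g (if v < letterBound w then letterBound w - v
          else letterBound w - ascentBound w + 1) := by
    refine Finset.sum_congr rfl fun v hv => ?_
    rw [Finset.mem_Ico, Nat.lt_succ_iff] at hv
    rw [letterBound_cons, ascentBound_cons (by rw [ascentBound_shift hv.1]; exact hv.1),
      ascentBound_shift hv.1, letterBound_shift]
    congr 1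
    split_ifs <;> omega
  rw [e1, e2, Finset.sum_Ico_succ_top hle, Finset.sum_Ico_eq_sum_range,
    Finset.sum_Ico_eq_sum_range, if_neg (lt_irrefl _)]
  obtain ⟨h, hh⟩ := Nat.exists_eq_add_of_le hle
  simp only [hh, Nat.add_sub_cancel_left]
  generalize ascentBound w = c
  have e3 : ∑ k ∈ Finset.range h, g (if c + k < c + h then c + h - (c + k) else h + 1) =
      ∑ i ∈ Finset.range h, g (i + 1) := by
    rw [← Finset.sum_range_reflect]
    refine Finset.sum_congr rfl fun k hk => ?_
    rw [Finset.mem_range] at hk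
    rw [if_pos (by omega)]
    congr 1
    omega
  have e4 : ∑ k ∈ Finset.range h, g (if c + k + 1 < c + h then c + h - (c + k + 1) else h) =
      ∑ i ∈ Finset.range h, g (i + 1) := by
    rcases h with _ | h
    · rfl
    rw [Finset.sum_range_succ, Finset.sum_range_succ, if_neg (by omega),
      ← Finset.sum_range_reflect]
    congr 1
    refine Finset.sum_congr rfl fun k hk => ?_
    rw [Finset.mem_range] at hk
    rw [if_pos (by omega)]
    congr 1
    omega
  rw [e3, e4]
  ring

theorem sum_extensionCount (m n : ℕ) :
    ∑ w ∈ goodWords n, extensionCount m (letterBound w - ascentBound w) =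
      extensionCount (m + n) 0 := by
  induction n generalizing m with
  | zero =>
    have h : goodWords 0 = Finset.univ := by
      refine Finset.eq_univ_of_forall fun w => mem_goodWords.2 ?_
      simp [IsGoodWord]
    rw [h]
    simp [letterBound]
  | succ n ih =>
    rw [sum_goodWords_succ]
    simp only [sum_extensions]
    rw [show m + (n + 1) = m + 1 + n by ring, ← ih]
    rfl

theorem card_goodWords (n : ℕ) : (goodWords n).card = extensionCount n 0 := by
  have h := sum_extensionCount 0 n
  rw [Nat.zero_add] at h
  simpa [extensionCount] using h

/-- Coefficients of the powers of the generating function of the large Schröder numbers,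
refined by the exponent of `2`. -/
def schroderTerm (M J h : ℕ) : ℤ :=
  M.choose J * (M + h + 1).choose (J + 1) - (M + 1).choose (J + 1) * (M + h).choose J

/-- Coefficients of the `h`-th power of the generating function of the large Schröder numbers. -/
def schroderPow : ℕ → ℕ → ℤ
  | 0, _ => 1
  | M + 1, h => ∑ J ∈ Finset.range (M + 1), 2 ^ (J + 1) * schroderTerm M J h

theorem schroderTerm_zero (M h : ℕ) : schroderTerm M 0 h = h := by
  simp [schroderTerm]

theorem schroderTerm_succ (M J h : ℕ) :
    schroderTerm (M + 1) (J + 1) (h + 1) = schroderTerm (M + 1) (J + 1) h +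
      schroderTerm M (J + 1) (h + 2) - schroderTerm M (J + 1) (h + 1) +
        schroderTerm M J (h + 1) := by
  simp only [schroderTerm, show M + 1 + (h + 1) = M + h + 1 + 1 by ring,
    show M + 1 + h = M + h + 1 by ring,
    show M + (h + 2) = M + h + 1 + 1 by ring, show M + (h + 1) = M + h + 1 by ring,
    Nat.choose_succ_succ', Nat.cast_add]
  ring

theorem schroderTerm_eq_zero (M h : ℕ) : schroderTerm M (M + 1) h = 0 := by
  simp [schroderTerm]

theorem schroderPow_succ_zero (m : ℕ) : schroderPow (m + 1) 0 = 0 := by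
  refine Finset.sum_eq_zero fun J _ => ?_
  simp only [schroderTerm, Nat.add_zero]
  ring

theorem schroderPow_succ_succ (m h : ℕ) :
    schroderPow (m + 1) (h + 1) =
      schroderPow (m + 1) h + schroderPow m (h + 2) + schroderPow m (h + 1) := by
  rcases m with _ | M
  · simp [schroderPow, schroderTerm_zero]
    ring
  have e : ∀ k, schroderPow (M + 1) k =
      ∑ J ∈ Finset.range (M + 1), 2 ^ (J + 2) * schroderTerm M (J + 1) k + 2 * k := by
    intro k
    have h1 : schroderPow (M + 1) k =
        ∑ J ∈ Finset.range (M + 2), 2 ^ (J + 1) * schroderTerm M J k := by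
      rw [Finset.sum_range_succ, schroderTerm_eq_zero, mul_zero, add_zero]
      rfl
    rw [h1, Finset.sum_range_succ', schroderTerm_zero]
    ring
  have e' : ∀ k, schroderPow (M + 2) k =
      ∑ J ∈ Finset.range (M + 1), 2 ^ (J + 2) * schroderTerm (M + 1) (J + 1) k + 2 * k := by
    intro k
    rw [schroderPow, Finset.sum_range_succ', schroderTerm_zero]
    ring
  have e2 : ∑ J ∈ Finset.range (M + 1), 2 ^ (J + 2) * schroderTerm (M + 1) (J + 1) (h + 1) =
      ∑ J ∈ Finset.range (M + 1), 2 ^ (J + 2) * schroderTerm (M + 1) (J + 1) h +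
      ∑ J ∈ Finset.range (M + 1), 2 ^ (J + 2) * schroderTerm M (J + 1) (h + 2) -
      ∑ J ∈ Finset.range (M + 1), 2 ^ (J + 2) * schroderTerm M (J + 1) (h + 1) +
      2 * schroderPow (M + 1) (h + 1) := by
    rw [schroderPow, Finset.mul_sum, ← Finset.sum_add_distrib, ← Finset.sum_sub_distrib,
      ← Finset.sum_add_distrib]
    refine Finset.sum_congr rfl fun J _ => ?_
    rw [schroderTerm_succ]
    ring
  have h1 := e (h + 1)
  have h2 := e (h + 2)
  have h3 := e' (h + 1)
  have h4 := e' h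
  push_cast at h1 h2 h3 h4
  linarith

theorem two_mul_extensionCount (m h : ℕ) :
    2 * (extensionCount m h : ℤ) = schroderPow m h + schroderPow m (h + 1) := by
  induction m generalizing h with
  | zero => simp [extensionCount, schroderPow]
  | succ m ih =>
    induction h with
    | zero =>
      rw [schroderPow_succ_succ, schroderPow_succ_zero]
      simp only [extensionCount, Finset.range_zero, Finset.sum_empty]
      have := ih 1
      push_cast
      linarith
    | succ h ihh =>
      have h1 := schroderPow_succ_succ m h
      have h2 := schroderPow_succ_succ m (h + 1)
      have h3 := ih (h + 1)
      have h4 := ih (h + 2)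
      simp only [extensionCount, Finset.sum_range_succ] at ihh ⊢
      push_cast at ihh ⊢
      linarith

theorem succ_mul_schroderTerm_one (M J : ℕ) :
    (M + 1 : ℤ) * schroderTerm M J 1 = (M + 1).choose J * (M + 1).choose (J + 1) := by
  have h1 := Nat.add_one_mul_choose_eq M J
  have h2 := Nat.add_one_mul_choose_eq (M + 1) J
  zify at h1 h2
  unfold schroderTerm
  linear_combination ((M + 1 + 1).choose (J + 1) : ℤ) * h1 - ((M + 1).choose (J + 1) : ℤ) * h2

/-- The number of ordered set partitions of `[n]` avoiding the condition
`x_{i1} ≤ x_{i2} < x_{i3}` equals `Σ_{v=0}^{n-1} 2^v · N_{n,v}`, where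
`N_{n,v} = (1/n)·binom(n,v)·binom(n,v+1)` is the Narayana number
(this count is the `n`-th little Schröder number). -/
theorem woc_active_lelt (n : ℕ) (hn : 1 ≤ n) :
    (Nat.card {p : Fin n → Fin n // IsOSP p ∧ ¬ ChainLeLt p} : ℚ)
      = ∑ v ∈ Finset.range n,
          2 ^ v * ((n.choose v : ℚ) * (n.choose (v + 1) : ℚ) / n) := by
  obtain ⟨M, rfl⟩ := Nat.exists_eq_add_of_le' hn
  rw [card_eq_card_goodWords, card_goodWords]
  have h := two_mul_extensionCount (M + 1) 0
  rw [schroderPow_succ_zero, zero_add, schroderPow] at h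
  have h' : (2 * extensionCount (M + 1) 0 : ℚ) =
      ∑ J ∈ Finset.range (M + 1), 2 ^ (J + 1) * (schroderTerm M J 1 : ℚ) := by
    exact_mod_cast h
  rw [← mul_right_inj' (two_ne_zero (α := ℚ)), h', Finset.mul_sum]
  refine Finset.sum_congr rfl fun J _ => ?_
  have h2 : (M + 1 : ℚ) * schroderTerm M J 1 = (M + 1).choose J * (M + 1).choose (J + 1) := by
    exact_mod_cast succ_mul_schroderTerm_one M J
  have h3 : (M + 1 : ℚ) ≠ 0 := by positivity
  rw [← h2]
  push_cast
  field_simp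
  ring
end
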